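/- arXiv:1412.3129 — 3 statements merged into one kernel-verified Lean document; each statement's English description precedes it below -/
import Mathlib

section
/- Assume (UM): g satisfies (H), L_g = g'(0), and g is bounded. Assume further that g is unimodal with a unique point x_m ∈ (0,κ) of local extremum, which is a maximum, that g is differentiable with |g'(x)| < 1 for all x ∈ [g(g(x_m)), g(x_m)]. Let w₀ satisfy (IC1) and (IC2), let c > c_# (χ₀(·;c) has two distinct positive real zeros λ₁(c) < λ₂(c)), fix λ ∈ (λ₁(c), λ₂(c)), and let φ be a semi-wavefront with speed c such that sup_{s∈[−h,0]} |φ(·+cs) − w₀(s,·)|_λ < ∞. Then φ is a wavefront (φ(+∞) = κ) and there exist ρ > 0, γ > 0 such that every classical solution u of (*) with initial datum w₀ satisfies sup_{x∈ℝ} |u(t,x) − φ(x+ct)| / η_λ(x+ct) ≤ 0.5ρ e^{−γt} for all t ≥ 0. -/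
open Set Filter

noncomputable section

/-- The weight function `η_λ(t) = min{e^{λt}, 1}`. -/
def eta (lam t : ℝ) : ℝ := min (Real.exp (lam * t)) 1

/-- The characteristic function `χ₀(λ) = λ² − cλ − 1 + g0·e^{−λch}` (with `g0 = g'(0)`). -/
def chi (g0 c h lam : ℝ) : ℝ := lam ^ 2 - c * lam - 1 + g0 * Real.exp (-(lam * c * h))

/-- Hypothesis (H) on the birth function `g` (extended linearly and C¹-smoothly to `(−∞,0]`). -/
structure HypH (g : ℝ → ℝ) (kap del0 Lg : ℝ) : Prop where
  cont : Continuous g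
  nonneg : ∀ x : ℝ, 0 ≤ x → 0 ≤ g x
  kap_pos : 0 < kap
  del0_pos : 0 < del0
  fixed_points : ∀ x : ℝ, 0 ≤ x → (g x = x ↔ x = 0 ∨ x = kap)
  smooth0 : ContDiffOn ℝ 1 g (Set.Ioo (-del0) del0)
  smooth_kap : ContDiffOn ℝ 1 g (Set.Ioo (kap - del0) (kap + del0))
  deriv0_gt : 1 < deriv g 0
  deriv_kap_lt : deriv g kap < 1
  lipschitz : ∀ u v : ℝ, 0 ≤ u → 0 ≤ v → |g u - g v| ≤ Lg * |u - v|
  holder : ∃ C > (0:ℝ), ∃ θ ∈ Set.Ioc (0:ℝ) 1,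
      ∀ u ∈ Set.Ioc (0:ℝ) del0, |deriv g u - deriv g 0| ≤ C * u ^ θ
  ext_linear : ∀ x : ℝ, x ≤ 0 → g x = deriv g 0 * x

/-- (IC1): `0 ≤ w₀ ≤ sup w₀ < ∞` on `Π₀ = [−h,0]×ℝ`. -/
def IC1 (h : ℝ) (w0 : ℝ → ℝ → ℝ) : Prop :=
  ∃ M : ℝ, ∀ s ∈ Set.Icc (-h) 0, ∀ x : ℝ, 0 ≤ w0 s x ∧ w0 s x ≤ M

/-- (IC2): `liminf_{x→+∞} min_{s∈[−h,0]} w₀(s,x) > 0`. -/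
def IC2 (h : ℝ) (w0 : ℝ → ℝ → ℝ) : Prop :=
  ∃ m > (0:ℝ), ∃ X : ℝ, ∀ x ≥ X, ∀ s ∈ Set.Icc (-h) 0, m ≤ w0 s x

/-- `w₀` is locally Hölder continuous in `x`, uniformly in `s ∈ [−h,0]`. -/
def LocHolder (h : ℝ) (w0 : ℝ → ℝ → ℝ) : Prop :=
  ∀ R > (0:ℝ), ∃ K > (0:ℝ), ∃ β ∈ Set.Ioc (0:ℝ) 1,
    ∀ s ∈ Set.Icc (-h) 0, ∀ x ∈ Set.Icc (-R) R, ∀ y ∈ Set.Icc (-R) R,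
      |w0 s x - w0 s y| ≤ K * |x - y| ^ β

/-- A classical solution of the equation (*):
`u_t(t,x) = u_{xx}(t,x) − u(t,x) + g(u(t−h,x))` for `t > 0`, `x ∈ ℝ`. -/
def SolvesStar (g : ℝ → ℝ) (h : ℝ) (u : ℝ → ℝ → ℝ) : Prop :=
  ContinuousOn (fun p : ℝ × ℝ => u p.1 p.2) {p : ℝ × ℝ | -h ≤ p.1} ∧
  (∀ T : ℝ, ∃ M : ℝ, ∀ t ∈ Set.Icc (-h) T, ∀ x : ℝ, |u t x| ≤ M) ∧
  (∀ t : ℝ, 0 < t → ∀ x : ℝ,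
      DifferentiableAt ℝ (fun τ => u τ x) t ∧
      DifferentiableAt ℝ (fun y => u t y) x ∧
      DifferentiableAt ℝ (deriv (fun y => u t y)) x ∧
      deriv (fun τ => u τ x) t =
        deriv (deriv (fun y => u t y)) x - u t x + g (u (t - h) x)) ∧
  ContinuousOn (fun p : ℝ × ℝ => deriv (fun τ => u τ p.2) p.1) {p : ℝ × ℝ | 0 < p.1} ∧
  ContinuousOn (fun p : ℝ × ℝ => deriv (fun y => u p.1 y) p.2) {p : ℝ × ℝ | 0 < p.1} ∧
  ContinuousOn (fun p : ℝ × ℝ => deriv (deriv (fun y => u p.1 y)) p.2) {p : ℝ × ℝ | 0 < p.1}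

/-- A classical solution of equation (E1):
`w_t = w_{zz} − c w_z − w + g(w(t−h, z−ch))` for `t > 0`, `z ∈ ℝ`. -/
def SolvesE1 (g : ℝ → ℝ) (h c : ℝ) (w : ℝ → ℝ → ℝ) : Prop :=
  ContinuousOn (fun p : ℝ × ℝ => w p.1 p.2) {p : ℝ × ℝ | -h ≤ p.1} ∧
  (∀ T : ℝ, ∃ M : ℝ, ∀ t ∈ Set.Icc (-h) T, ∀ z : ℝ, |w t z| ≤ M) ∧
  (∀ t : ℝ, 0 < t → ∀ z : ℝ,
      DifferentiableAt ℝ (fun τ => w τ z) t ∧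
      DifferentiableAt ℝ (fun y => w t y) z ∧
      DifferentiableAt ℝ (deriv (fun y => w t y)) z ∧
      deriv (fun τ => w τ z) t =
        deriv (deriv (fun y => w t y)) z - c * deriv (fun y => w t y) z
          - w t z + g (w (t - h) (z - c * h))) ∧
  ContinuousOn (fun p : ℝ × ℝ => deriv (fun τ => w τ p.2) p.1) {p : ℝ × ℝ | 0 < p.1} ∧
  ContinuousOn (fun p : ℝ × ℝ => deriv (fun y => w p.1 y) p.2) {p : ℝ × ℝ | 0 < p.1} ∧
  ContinuousOn (fun p : ℝ × ℝ => deriv (deriv (fun y => w p.1 y)) p.2) {p : ℝ × ℝ | 0 < p.1}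

/-- A wavefront with speed `c`: a positive bounded C² solution of the profile equation
with `φ(−∞) = 0`, `φ(+∞) = κ`. -/
def IsWavefront (g : ℝ → ℝ) (h c kap : ℝ) (φ : ℝ → ℝ) : Prop :=
  (∀ z : ℝ, 0 < φ z) ∧ (∃ M : ℝ, ∀ z : ℝ, φ z ≤ M) ∧ ContDiff ℝ 2 φ ∧
  (∀ z : ℝ, deriv (deriv φ) z - c * deriv φ z - φ z + g (φ (z - c * h)) = 0) ∧
  Filter.Tendsto φ Filter.atBot (nhds 0) ∧ Filter.Tendsto φ Filter.atTop (nhds kap)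

/-- A semi-wavefront with speed `c`: as a wavefront, but at `+∞` only
`liminf_{z→+∞} φ(z) > 0` is required. -/
def IsSemiWavefront (g : ℝ → ℝ) (h c : ℝ) (φ : ℝ → ℝ) : Prop :=
  (∀ z : ℝ, 0 < φ z) ∧ (∃ M : ℝ, ∀ z : ℝ, φ z ≤ M) ∧ ContDiff ℝ 2 φ ∧
  (∀ z : ℝ, deriv (deriv φ) z - c * deriv φ z - φ z + g (φ (z - c * h)) = 0) ∧
  Filter.Tendsto φ Filter.atBot (nhds 0) ∧
  (∃ m > (0:ℝ), ∀ᶠ z in Filter.atTop, m ≤ φ z)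

/-- The nonlinear operator `𝒩` associated with (E1). -/
def Nop (g : ℝ → ℝ) (h c : ℝ) (w : ℝ → ℝ → ℝ) (t z : ℝ) : ℝ :=
  deriv (fun τ => w τ z) t - deriv (deriv (fun y => w t y)) z
    + c * deriv (fun y => w t y) z + w t z - g (w (t - h) (z - c * h))

/-- A super-solution of (E1) with break point `zs`. -/
def IsSuperSolution (g : ℝ → ℝ) (h c : ℝ) (w : ℝ → ℝ → ℝ) (zs : ℝ) : Prop :=
  ContinuousOn (fun p : ℝ × ℝ => w p.1 p.2) {p : ℝ × ℝ | -h ≤ p.1} ∧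
  (∀ t : ℝ, -h < t → ∀ z : ℝ, DifferentiableAt ℝ (fun τ => w τ z) t) ∧
  (∀ t : ℝ, -h ≤ t → ∀ z : ℝ, z ≠ zs →
      DifferentiableAt ℝ (fun y => w t y) z ∧
      DifferentiableAt ℝ (deriv (fun y => w t y)) z) ∧
  (∀ t : ℝ, 0 < t → ∀ z : ℝ, z ≠ zs → 0 ≤ Nop g h c w t z) ∧
  (∀ t : ℝ, 0 < t →
      derivWithin (fun y => w t y) (Set.Iic zs) zs
        > derivWithin (fun y => w t y) (Set.Ici zs) zs)

/-- A sub-solution of (E1) with break point `zs` (all inequalities reversed). -/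
def IsSubSolution (g : ℝ → ℝ) (h c : ℝ) (w : ℝ → ℝ → ℝ) (zs : ℝ) : Prop :=
  ContinuousOn (fun p : ℝ × ℝ => w p.1 p.2) {p : ℝ × ℝ | -h ≤ p.1} ∧
  (∀ t : ℝ, -h < t → ∀ z : ℝ, DifferentiableAt ℝ (fun τ => w τ z) t) ∧
  (∀ t : ℝ, -h ≤ t → ∀ z : ℝ, z ≠ zs →
      DifferentiableAt ℝ (fun y => w t y) z ∧
      DifferentiableAt ℝ (deriv (fun y => w t y)) z) ∧
  (∀ t : ℝ, 0 < t → ∀ z : ℝ, z ≠ zs → Nop g h c w t z ≤ 0) ∧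
  (∀ t : ℝ, 0 < t →
      derivWithin (fun y => w t y) (Set.Iic zs) zs
        < derivWithin (fun y => w t y) (Set.Ici zs) zs)

open scoped Topology

/-- At `(t, x)` the function `D` has time derivative `a` and second space derivative `b`. -/
def HasJet (D : ℝ → ℝ → ℝ) (t x a b : ℝ) : Prop :=
  HasDerivAt (fun τ => D τ x) a t ∧
    ∃ d : ℝ → ℝ, (∀ y, HasDerivAt (fun y => D t y) (d y) y) ∧ HasDerivAt d b x

namespace HasJet

variable {D E : ℝ → ℝ → ℝ} {t x a b a' b' : ℝ}

theorem add (h₁ : HasJet D t x a b) (h₂ : HasJet E t x a' b') :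
    HasJet (fun t x => D t x + E t x) t x (a + a') (b + b') := by
  obtain ⟨hD, d, hd, hb⟩ := h₁
  obtain ⟨hE, e, he, hb'⟩ := h₂
  exact ⟨hD.add hE, fun y => d y + e y, fun y => (hd y).add (he y), hb.add hb'⟩

theorem sub (h₁ : HasJet D t x a b) (h₂ : HasJet E t x a' b') :
    HasJet (fun t x => D t x - E t x) t x (a - a') (b - b') := by
  obtain ⟨hD, d, hd, hb⟩ := h₁
  obtain ⟨hE, e, he, hb'⟩ := h₂
  exact ⟨hD.sub hE, fun y => d y - e y, fun y => (hd y).sub (he y), hb.sub hb'⟩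

theorem const (k t x : ℝ) : HasJet (fun _ _ => k) t x 0 0 :=
  ⟨hasDerivAt_const _ _, fun _ => 0, fun _ => hasDerivAt_const _ _, hasDerivAt_const _ _⟩

theorem exp_linear (k p q r t x : ℝ) :
    HasJet (fun t x => k * Real.exp (p * t + q * x + r)) t x
      (p * (k * Real.exp (p * t + q * x + r))) (q ^ 2 * (k * Real.exp (p * t + q * x + r))) := by
  have hq : ∀ k y : ℝ, HasDerivAt (fun y => k * Real.exp (p * t + q * y + r))
      (q * k * Real.exp (p * t + q * y + r)) y := fun k y =>
    (((((hasDerivAt_id' y).const_mul q).const_add (p * t)).add_const r).exp.const_mul k).congr_deriv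
      (by ring)
  refine ⟨?_, fun y => q * k * Real.exp (p * t + q * y + r), hq k, ?_⟩
  · exact (((((hasDerivAt_id' t).const_mul p).add_const (q * x)).add_const r).exp.const_mul
      k).congr_deriv (by ring)
  · exact (hq (q * k) x).congr_deriv (by ring)

theorem sq (k t x : ℝ) : HasJet (fun _ x => k * (x ^ 2 + 3)) t x 0 (2 * k) := by
  refine ⟨hasDerivAt_const _ _, fun y => k * (2 * y), fun y => ?_, ?_⟩
  · exact (((hasDerivAt_pow 2 y).add_const 3).const_mul k).congr_deriv (by norm_num)
  · exact (((hasDerivAt_id' x).const_mul 2).const_mul k).congr_deriv (by ring)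

end HasJet

theorem HasDerivAt.nonneg_of_isMaxOn_left {f : ℝ → ℝ} {a t : ℝ} (hf : HasDerivAt f a t)
    (hmax : ∀ᶠ τ in 𝓝[<] t, f τ ≤ f t) : 0 ≤ a := by
  have h := hf.hasDerivWithinAt (s := Iio t)
  rw [hasDerivWithinAt_iff_tendsto_slope' (by simp)] at h
  refine ge_of_tendsto h ?_
  filter_upwards [hmax, self_mem_nhdsWithin] with τ hτ hlt
  rw [slope_def_field]
  exact div_nonneg_of_nonpos (by linarith) (by simp at hlt; linarith)

theorem IsLocalMax.second_deriv_nonpos {f d : ℝ → ℝ} {b x : ℝ}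
    (hf : ∀ y, HasDerivAt f (d y) y) (hd : HasDerivAt d b x) (hmax : IsLocalMax f x) :
    b ≤ 0 := by
  by_contra! hb
  have hderiv : deriv f = d := funext fun y => (hf y).deriv
  have hmin : IsLocalMin f x :=
    isLocalMin_of_deriv_deriv_pos (by rw [hderiv, hd.deriv]; exact hb)
      hmax.deriv_eq_zero (hf x).continuousAt
  have hconst : f =ᶠ[𝓝 x] fun _ => f x := by
    filter_upwards [hmax, hmin] with y h₁ h₂ using le_antisymm h₁ h₂
  have h2 : deriv (deriv f) x = 0 := by
    have := hconst.deriv.deriv_eq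
    simpa using this
  rw [hderiv, hd.deriv] at h2
  exact hb.ne' h2

theorem HasJet.nonneg_nonpos_of_max {D : ℝ → ℝ → ℝ} {F : Set (ℝ × ℝ)} {t x a b : ℝ}
    (hD : HasJet D t x a b) (hF : F ∈ 𝓝 (t, x))
    (hmax : ∀ p ∈ F, p.1 ≤ t → D p.1 p.2 ≤ D t x) : 0 ≤ a ∧ b ≤ 0 := by
  obtain ⟨ht, d, hd, hb⟩ := hD
  constructor
  · apply ht.nonneg_of_isMaxOn_left
    have hc : Tendsto (fun τ => (τ, x)) (𝓝[<] t) (𝓝 (t, x)) :=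
      ((continuous_id.prodMk continuous_const).tendsto t).mono_left nhdsWithin_le_nhds
    filter_upwards [hc hF, self_mem_nhdsWithin] with τ hτ hlt
    exact hmax _ hτ (le_of_lt hlt)
  · apply IsLocalMax.second_deriv_nonpos hd hb
    have hc : Tendsto (fun y => (t, y)) (𝓝 x) (𝓝 (t, x)) :=
      (continuous_const.prodMk continuous_id).tendsto x
    filter_upwards [hc hF] with y hy
    exact hmax _ hy le_rfl

/-- A weak maximum principle for bounded subsolutions of `D_t = D_xx - D` on the part of a closed
set `F` lying in the strip `[T₀, T₁] × ℝ`. -/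
theorem parabolic_max_principle {D : ℝ → ℝ → ℝ} {F : Set (ℝ × ℝ)} {T₀ T₁ B : ℝ}
    (hF : IsClosed F)
    (hcont : ContinuousOn (fun p : ℝ × ℝ => D p.1 p.2) (Icc T₀ T₁ ×ˢ univ))
    (hB : ∀ t ∈ Icc T₀ T₁, ∀ x, (t, x) ∈ F → D t x ≤ B)
    (hD : ∀ t ∈ Icc T₀ T₁, ∀ x, (t, x) ∈ F → 0 < D t x →
      T₀ < t ∧ F ∈ 𝓝 (t, x) ∧ ∃ a b, HasJet D t x a b ∧ a ≤ b - D t x) :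
    ∀ t ∈ Icc T₀ T₁, ∀ x, (t, x) ∈ F → D t x ≤ 0 := by
  intro t₀ ht₀ x₀ hx₀
  by_contra! hpos
  set ε := D t₀ x₀ / (2 * (x₀ ^ 2 + 3)) with hε
  have hεpos : 0 < ε := by positivity
  have hstart : D t₀ x₀ - ε * (x₀ ^ 2 + 3) = D t₀ x₀ / 2 := by
    rw [hε]; field_simp; ring
  have hBpos : 0 < B := hpos.trans_le (hB _ ht₀ _ hx₀)
  set R := |x₀| + B / ε + 1 with hR
  have hRpos : 1 ≤ R := by
    have : 0 ≤ B / ε := by positivity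
    have := abs_nonneg x₀
    linarith
  set S : Set (ℝ × ℝ) := (Icc T₀ T₁ ×ˢ Icc (-R) R) ∩ F with hS
  have hScomp : IsCompact S := (isCompact_Icc.prod isCompact_Icc).inter_right hF
  have hmem : (t₀, x₀) ∈ S := by
    refine ⟨⟨ht₀, abs_le.mp ?_⟩, hx₀⟩
    have : 0 ≤ B / ε := by positivity
    simp only; linarith
  have hcontS : ContinuousOn (fun p : ℝ × ℝ => D p.1 p.2 - ε * (p.2 ^ 2 + 3)) S := by
    refine ContinuousOn.sub (hcont.mono ?_) (by fun_prop)
    rintro p ⟨⟨h1, -⟩, -⟩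
    exact ⟨h1, mem_univ _⟩
  obtain ⟨⟨t, x⟩, ⟨⟨ht, hx⟩, hxF⟩, hmax⟩ := hScomp.exists_isMaxOn ⟨_, hmem⟩ hcontS
  have hglob : ∀ p ∈ F, p.1 ∈ Icc T₀ T₁ →
      D p.1 p.2 - ε * (p.2 ^ 2 + 3) ≤ D t x - ε * (x ^ 2 + 3) := by
    intro p hpF hp1
    by_cases hp2 : p.2 ∈ Icc (-R) R
    · exact hmax ⟨⟨hp1, hp2⟩, hpF⟩
    · have h1 : R < |p.2| := by
        by_contra! h
        exact hp2 (abs_le.mp h)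
      have h2 : D t₀ x₀ / 2 ≤ D t x - ε * (x ^ 2 + 3) := by
        rw [← hstart]; exact hmax hmem
      have h3 : R ≤ p.2 ^ 2 := by
        rw [← sq_abs]; nlinarith
      have h4 : B ≤ ε * p.2 ^ 2 := by
        have : B / ε ≤ p.2 ^ 2 := by have := abs_nonneg x₀; linarith
        rwa [div_le_iff₀' hεpos] at this
      have := hB p.1 hp1 p.2 hpF
      nlinarith
  have h2 : 0 < D t x - ε * (x ^ 2 + 3) := by
    have : D t₀ x₀ / 2 ≤ D t x - ε * (x ^ 2 + 3) := by rw [← hstart]; exact hmax hmem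
    linarith
  have hx2 : 0 ≤ ε * x ^ 2 := by positivity
  obtain ⟨hT, hFn, a, b, hjet, hab⟩ := hD t ht x hxF (by linarith)
  have hF' : F ∩ {p | T₀ ≤ p.1} ∈ 𝓝 (t, x) := by
    refine inter_mem hFn ?_
    exact (continuous_fst.tendsto (t, x)).eventually (eventually_ge_nhds hT)
  obtain ⟨ha, hb⟩ := (hjet.sub (HasJet.sq ε t x)).nonneg_nonpos_of_max hF' (by
    rintro p ⟨hpF, hpT⟩ hpt
    exact hglob p hpF ⟨hpT, hpt.trans ht.2⟩)
  linarith

/-- Locally bounded solutions of the delayed equation, with pointwise derivatives. -/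
structure IsDelaySol (g : ℝ → ℝ) (h : ℝ) (u : ℝ → ℝ → ℝ) : Prop where
  cont : ContinuousOn (fun p : ℝ × ℝ => u p.1 p.2) {p : ℝ × ℝ | -h ≤ p.1}
  bdd : ∀ T : ℝ, ∃ M : ℝ, ∀ t ∈ Icc (-h) T, ∀ x : ℝ, |u t x| ≤ M
  jet : ∀ t, 0 < t → ∀ x, ∃ a b, HasJet u t x a b ∧ a = b - u t x + g (u (t - h) x)

theorem SolvesStar.isDelaySol {g : ℝ → ℝ} {h : ℝ} {u : ℝ → ℝ → ℝ} (hu : SolvesStar g h u) :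
    IsDelaySol g h u := by
  obtain ⟨h1, h2, h3, -⟩ := hu
  refine ⟨h1, h2, fun t ht x => ⟨_, _, ⟨(h3 t ht x).1.hasDerivAt,
    deriv (fun y => u t y), fun y => (h3 t ht y).2.1.hasDerivAt, (h3 t ht x).2.2.1.hasDerivAt⟩,
    (h3 t ht x).2.2.2⟩⟩

theorem IsSemiWavefront.isDelaySol {g : ℝ → ℝ} {h c : ℝ} {φ : ℝ → ℝ}
    (hφ : IsSemiWavefront g h c φ) : IsDelaySol g h (fun t x => φ (x + c * t)) := by
  obtain ⟨hpos, ⟨M, hM⟩, hsm, heq, -⟩ := hφ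
  have hd : Differentiable ℝ φ := hsm.differentiable (by norm_num)
  have hd2 : Differentiable ℝ (deriv φ) := by
    have : ContDiff ℝ (1 + 1) φ := by simpa [one_add_one_eq_two] using hsm
    exact (contDiff_succ_iff_deriv.mp this).2.2.differentiable (by norm_num)
  refine ⟨?_, fun T => ⟨M, fun t _ x => ?_⟩, fun t _ x => ?_⟩
  · exact (hd.continuous.comp (by fun_prop)).continuousOn
  · rw [abs_of_pos (hpos _)]; exact hM _
  · refine ⟨c * deriv φ (x + c * t), deriv (deriv φ) (x + c * t), ⟨?_, fun y =>
      deriv φ (y + c * t), fun y => ?_, ?_⟩, ?_⟩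
    · have h1 : HasDerivAt (fun τ => x + c * τ) c t :=
        (((hasDerivAt_id' t).const_mul c).const_add x).congr_deriv (by ring)
      exact ((hd _).hasDerivAt.comp t h1).congr_deriv (by ring)
    · exact (hd _).hasDerivAt.comp_add_const y (c * t)
    · exact (hd2 _).hasDerivAt.comp_add_const x (c * t)
    · have := heq (x + c * t)
      rw [show x + c * (t - h) = x + c * t - c * h by ring]
      linarith

theorem delay_induction {P : ℝ → Prop} {h T : ℝ} (hh : 0 < h)
    (base : ∀ t ∈ Icc (T - h) T, P t)
    (step : ∀ T' ≥ T, (∀ t ∈ Icc (T - h) T', P t) → ∀ t ∈ Icc T' (T' + h), P t) :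
    ∀ t ≥ T - h, P t := by
  have key : ∀ n : ℕ, ∀ t ∈ Icc (T - h) (T + n * h), P t := by
    intro n
    induction n with
    | zero => simpa using base
    | succ n ih =>
      intro t ht
      rcases le_total t (T + n * h) with h1 | h1
      · exact ih t ⟨ht.1, h1⟩
      · have : (0 : ℝ) ≤ n * h := by positivity
        refine step (T + n * h) (by linarith) ih t ⟨h1, ?_⟩
        have := ht.2
        push_cast at this
        linarith
  intro t ht
  obtain ⟨n, hn⟩ := exists_nat_ge ((t - T) / h)
  rw [div_le_iff₀ hh] at hn
  exact key n t ⟨ht, by linarith⟩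

namespace IsDelaySol

variable {g : ℝ → ℝ} {h : ℝ} {u v : ℝ → ℝ → ℝ}

theorem neg (hu : IsDelaySol g h u) :
    IsDelaySol (fun x => -g (-x)) h (fun t x => -u t x) := by
  refine ⟨hu.cont.neg, by simpa using hu.bdd, fun t ht x => ?_⟩
  obtain ⟨a, b, hjet, hab⟩ := hu.jet t ht x
  refine ⟨-a, -b, ?_, by simp only [neg_neg]; linarith⟩
  simpa using (HasJet.const 0 t x).sub hjet

theorem continuousOn_strip (hu : IsDelaySol g h u) (hh : 0 < h) {T₀ T₁ : ℝ} (hT : 0 ≤ T₀) :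
    ContinuousOn (fun p : ℝ × ℝ => u p.1 p.2) (Icc T₀ T₁ ×ˢ univ) := by
  refine hu.cont.mono ?_
  rintro p ⟨h1, -⟩
  simp only [mem_ofPred_eq]
  linarith [h1.1]

theorem nonneg (hu : IsDelaySol g h u) (hh : 0 < h) (hg : ∀ x, 0 ≤ x → 0 ≤ g x)
    (h0 : ∀ t ∈ Icc (-h) 0, ∀ x, 0 ≤ u t x) : ∀ t ≥ -h, ∀ x, 0 ≤ u t x := by
  have := delay_induction (P := fun t => ∀ x, 0 ≤ u t x) (T := 0) hh (by simpa using h0) ?_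
  · simpa using this
  intro T hT ih t ht x
  obtain ⟨M, hM⟩ := hu.bdd (T + h)
  have key := parabolic_max_principle (D := fun t x => 0 - u t x) (F := univ) (T₀ := T)
    (T₁ := T + h) (B := M) isClosed_univ
    (continuousOn_const.sub (hu.continuousOn_strip hh hT))
    (fun t ht x _ => by
      have := hM t ⟨by linarith [ht.1], ht.2⟩ x
      linarith [neg_abs_le (u t x)]) ?_ t ht x (mem_univ _)
  · linarith
  intro t ht x _ hneg
  have hTt : T < t := by
    rcases ht.1.lt_or_eq with h1 | h1
    · exact h1
    · have := ih T ⟨by linarith, le_rfl⟩ x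
      rw [h1] at this
      linarith
  obtain ⟨a, b, hjet, hab⟩ := hu.jet t (by linarith) x
  refine ⟨hTt, univ_mem, _, _, (HasJet.const 0 t x).sub hjet, ?_⟩
  have := hg _ (ih (t - h) ⟨by linarith, by linarith [ht.2]⟩ x)
  linarith

theorem le_of_forcing_le (hu : IsDelaySol g h u) (hh : 0 < h) {K : ℝ}
    (hg : ∀ t > 0, ∀ x, g (u (t - h) x) ≤ K)
    (h0 : ∀ x, u 0 x ≤ K) : ∀ t ≥ 0, ∀ x, u t x ≤ K := by
  intro t ht x
  obtain ⟨M, hM⟩ := hu.bdd t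
  have key := parabolic_max_principle (D := fun t x => u t x - K) (F := univ) (T₀ := 0)
    (T₁ := t) (B := M - K) isClosed_univ
    ((hu.continuousOn_strip hh le_rfl).sub continuousOn_const)
    (fun t ht x _ => by
      have := hM t ⟨by linarith [ht.1], ht.2⟩ x
      linarith [le_abs_self (u t x)]) ?_ t ⟨ht, le_rfl⟩ x (mem_univ _)
  · linarith
  intro t ht x _ hpos
  have hTt : 0 < t := by
    rcases ht.1.lt_or_eq with h1 | h1
    · exact h1
    · have := h0 x
      rw [h1] at this
      linarith
  obtain ⟨a, b, hjet, hab⟩ := hu.jet t hTt x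
  refine ⟨hTt, univ_mem, _, _, hjet.sub (HasJet.const K t x), ?_⟩
  have := hg t hTt x
  linarith

theorem sub_le_exp_step (hu : IsDelaySol g h u) (hv : IsDelaySol g h v) (hh : 0 < h)
    {p q L M T : ℝ} (hT : 0 ≤ T) (hM : 0 ≤ M) (hL : 0 ≤ L)
    (hpq : L * Real.exp (-(p * h)) ≤ 1 + p - q ^ 2)
    (hg : ∀ t ∈ Icc T (T + h), ∀ x, u t x - v t x ≤ M * Real.exp (p * t + q * x) ∨
      |g (u (t - h) x) - g (v (t - h) x)| ≤ L * |u (t - h) x - v (t - h) x|)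
    (h0 : ∀ t ∈ Icc (T - h) T, ∀ x, |u t x - v t x| ≤ M * Real.exp (p * t + q * x)) :
    ∀ t ∈ Icc T (T + h), ∀ x, u t x - v t x ≤ M * Real.exp (p * t + q * x) := by
  intro t ht x
  obtain ⟨A, hA⟩ := hu.bdd (T + h)
  obtain ⟨B, hB⟩ := hv.bdd (T + h)
  have key := parabolic_max_principle
    (D := fun t x => u t x - v t x - M * Real.exp (p * t + q * x + 0)) (F := univ) (T₀ := T)
    (T₁ := T + h) (B := A + B) isClosed_univ
    (((hu.continuousOn_strip hh hT).sub (hv.continuousOn_strip hh hT)).sub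
      (Continuous.continuousOn (by fun_prop)))
    (fun t ht x _ => by
      have h1 := hA t ⟨by linarith [ht.1], ht.2⟩ x
      have h2 := hB t ⟨by linarith [ht.1], ht.2⟩ x
      have : 0 ≤ M * Real.exp (p * t + q * x + 0) := by positivity
      linarith [le_abs_self (u t x), neg_abs_le (v t x)]) ?_ t ht x (mem_univ _)
  · simp only [add_zero] at key
    linarith
  intro t ht x _ hpos
  have hTt : T < t := by
    rcases ht.1.lt_or_eq with h1 | h1
    · exact h1
    · have := (le_abs_self _).trans (h0 T ⟨by linarith, le_rfl⟩ x)
      simp only [add_zero] at hpos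
      rw [h1] at this
      linarith
  obtain ⟨a, b, hjet, hab⟩ := hu.jet t (by linarith) x
  obtain ⟨a', b', hjet', hab'⟩ := hv.jet t (by linarith) x
  refine ⟨hTt, univ_mem, _, _, (hjet.sub hjet').sub (HasJet.exp_linear M p q 0 t x), ?_⟩
  simp only [add_zero] at hpos ⊢
  have h1 : |g (u (t - h) x) - g (v (t - h) x)| ≤ L * |u (t - h) x - v (t - h) x| :=
    (hg t ht x).resolve_left (by linarith)
  have h2 := mul_le_mul_of_nonneg_left
    (h0 (t - h) ⟨by linarith [ht.1], by linarith [ht.2]⟩ x) hL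
  have h3 : L * (M * Real.exp (p * (t - h) + q * x)) =
      (L * Real.exp (-(p * h))) * (M * Real.exp (p * t + q * x)) := by
    rw [show p * (t - h) + q * x = -(p * h) + (p * t + q * x) by ring, Real.exp_add]
    ring
  have h4 := mul_le_mul_of_nonneg_right hpq
    (show 0 ≤ M * Real.exp (p * t + q * x) by positivity)
  have h5 := le_abs_self (g (u (t - h) x) - g (v (t - h) x))
  linarith

/-- Exponential bounds for the difference of two solutions. -/
theorem abs_sub_le_exp (hu : IsDelaySol g h u) (hv : IsDelaySol g h v) (hh : 0 < h)
    {p q L M T : ℝ} (hT : 0 ≤ T) (hM : 0 ≤ M) (hL : 0 ≤ L)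
    (hpq : L * Real.exp (-(p * h)) ≤ 1 + p - q ^ 2)
    (hg : ∀ t ≥ T, ∀ x, |u t x - v t x| ≤ M * Real.exp (p * t + q * x) ∨
      |g (u (t - h) x) - g (v (t - h) x)| ≤ L * |u (t - h) x - v (t - h) x|)
    (h0 : ∀ t ∈ Icc (T - h) T, ∀ x, |u t x - v t x| ≤ M * Real.exp (p * t + q * x)) :
    ∀ t ≥ T - h, ∀ x, |u t x - v t x| ≤ M * Real.exp (p * t + q * x) := by
  refine delay_induction hh h0 fun T' hT' ih t ht x => abs_sub_le_iff.mpr ⟨?_, ?_⟩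
  · refine hu.sub_le_exp_step hv hh (hT.trans hT') hM hL hpq (fun t ht x => ?_)
      (fun t ht x => ih t ⟨by linarith [ht.1], ht.2⟩ x) t ht x
    exact (hg t (hT'.trans ht.1) x).imp_left (le_abs_self _).trans
  · refine hv.sub_le_exp_step hu hh (hT.trans hT') hM hL hpq (fun t ht x => ?_)
      (fun t ht x => ?_) t ht x
    · rw [abs_sub_comm (g _), abs_sub_comm (v _ _)]
      exact (hg t (hT'.trans ht.1) x).imp_left fun h => (abs_sub_le_iff.mp h).2
    · rw [abs_sub_comm]
      exact ih t ⟨by linarith [ht.1], ht.2⟩ x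

/-- An eventual bound on the delayed forcing ahead of a moving frame is inherited, up to an
arbitrarily small error, by the solution. -/
theorem eventually_le_of_forcing (hu : IsDelaySol g h u) (hh : 0 < h) {c B G T Z η : ℝ}
    (hc : 0 < c) (hB : ∀ t ≥ 0, ∀ x, u t x ≤ B) (hη : 0 < η)
    (hg : ∀ t ≥ T, ∀ x, Z ≤ x + c * t → g (u (t - h) x) ≤ G) :
    ∃ T' Z', ∀ t ≥ T', ∀ x, Z' ≤ x + c * t → u t x ≤ G + η := by
  wlog hT : 0 ≤ T generalizing T
  · exact this (T := 0) (fun t ht => hg t (by linarith)) le_rfl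
  set K := |B - G| + 1 with hK
  have hKpos : 0 < K := by positivity
  have hBK : B - G ≤ K := by linarith [le_abs_self (B - G)]
  obtain ⟨μ, hμ, hμc⟩ : ∃ μ > 0, μ * c + μ ^ 2 ≤ 1 := by
    refine ⟨1 / (c + 1), by positivity, ?_⟩
    rw [div_pow, div_mul_eq_mul_div, div_add_div _ _ (by positivity) (by positivity),
      div_le_one (by positivity)]
    nlinarith [mul_pos hc hc, mul_pos hc (mul_pos hc hc)]
  have main : ∀ t ≥ T, ∀ x, u t x - G - K * Real.exp (-1 * t + 0 * x + T)
      - K * Real.exp (-(μ * c) * t + -μ * x + μ * Z) ≤ 0 := by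
    intro t ht x
    refine parabolic_max_principle
      (D := fun t x => u t x - G - K * Real.exp (-1 * t + 0 * x + T)
        - K * Real.exp (-(μ * c) * t + -μ * x + μ * Z))
      (F := univ) (T₀ := T) (T₁ := t) (B := B - G) isClosed_univ
      ((((hu.continuousOn_strip hh hT).sub continuousOn_const).sub
        (Continuous.continuousOn (by fun_prop))).sub (Continuous.continuousOn (by fun_prop)))
      (fun t ht x _ => ?_) ?_ t ⟨ht, le_rfl⟩ x (mem_univ _)
    · have h1 : 0 ≤ K * Real.exp (-1 * t + 0 * x + T) := by positivity
      have h2 : 0 ≤ K * Real.exp (-(μ * c) * t + -μ * x + μ * Z) := by positivity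
      linarith [hB t (hT.trans ht.1) x]
    intro t ht x _ hpos
    have h1 : 0 < K * Real.exp (-1 * t + 0 * x + T) := by positivity
    have h2 : 0 < K * Real.exp (-(μ * c) * t + -μ * x + μ * Z) := by positivity
    have hub := hB t (hT.trans ht.1) x
    have hTt : T < t := by
      by_contra! hle
      have : 1 ≤ Real.exp (-1 * t + 0 * x + T) := Real.one_le_exp (by linarith)
      nlinarith
    have hZx : Z ≤ x + c * t := by
      by_contra! hle
      have : 1 ≤ Real.exp (-(μ * c) * t + -μ * x + μ * Z) := Real.one_le_exp (by nlinarith)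
      nlinarith
    obtain ⟨a, b, hjet, hab⟩ := hu.jet t (by linarith) x
    refine ⟨hTt, univ_mem, _, _, ((hjet.sub (HasJet.const G t x)).sub
      (HasJet.exp_linear K (-1) 0 T t x)).sub (HasJet.exp_linear K (-(μ * c)) (-μ) (μ * Z) t x), ?_⟩
    have h3 := hg t ht.1 x hZx
    have h4 := mul_le_mul_of_nonneg_right hμc h2.le
    linarith
  set S := Real.log (2 * K / η) with hS
  have hexp : ∀ s, s ≤ -S → K * Real.exp s ≤ η / 2 := by
    intro s hs
    have : Real.exp s ≤ η / (2 * K) := by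
      rw [← Real.exp_log (show 0 < η / (2 * K) by positivity)]
      refine Real.exp_le_exp.mpr (hs.trans_eq ?_)
      rw [hS, ← Real.log_inv, inv_div]
    calc K * Real.exp s ≤ K * (η / (2 * K)) := by gcongr
      _ = η / 2 := by field_simp
  refine ⟨max T (T + S), Z + S / μ, fun t ht x hx => ?_⟩
  have h1 := hexp (-1 * t + 0 * x + T) (by linarith [(le_max_right T (T + S)).trans ht])
  have h2 := hexp (-(μ * c) * t + -μ * x + μ * Z) (by
    have : S / μ * μ = S := by field_simp
    nlinarith)
  have := main t ((le_max_left _ _).trans ht) x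
  linarith

end IsDelaySol

/-- A unimodal map with fixed points `0` and `κ` which is a pointwise contraction on
`[g(g(x_m)), g(x_m)]`. -/
structure IsUnimodalContraction (g : ℝ → ℝ) (kap xm : ℝ) : Prop where
  cont : Continuous g
  nonneg : ∀ x, 0 ≤ x → 0 ≤ g x
  fixed : ∀ x, 0 ≤ x → (g x = x ↔ x = 0 ∨ x = kap)
  mem : xm ∈ Ioo 0 kap
  up : StrictMonoOn g (Icc 0 xm)
  down : StrictAntiOn g (Ici xm)
  contr : ∀ x ∈ Icc (g (g xm)) (g xm), DifferentiableAt ℝ g x ∧ |deriv g x| < 1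

namespace IsUnimodalContraction

variable {g : ℝ → ℝ} {kap xm : ℝ}

theorem map_kap (H : IsUnimodalContraction g kap xm) : g kap = kap :=
  (H.fixed kap (H.mem.1.trans H.mem.2).le).mpr (Or.inr rfl)

theorem lt_map (H : IsUnimodalContraction g kap xm) {x : ℝ} (hx : x ∈ Ioo 0 kap) : x < g x := by
  have hright : ∀ y, xm ≤ y → y < kap → y < g y := fun y h1 h2 => by
    have := H.down h1 (h1.trans h2.le) h2
    rw [H.map_kap] at this
    exact h2.trans this
  by_contra! hle
  have hxm : x < xm := by
    by_contra! h1
    exact absurd (hright x h1 hx.2) hle.not_gt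
  have hcont : ContinuousOn (fun y => g y - y) (Icc x xm) := (H.cont.sub continuous_id).continuousOn
  obtain ⟨y, hy, hy0⟩ := intermediate_value_Icc hxm.le hcont
    (show (0 : ℝ) ∈ Icc (g x - x) (g xm - xm) from
      ⟨by linarith, by linarith [hright xm le_rfl H.mem.2]⟩)
  have hy' : g y = y := by simpa [sub_eq_zero] using hy0
  have hy1 : 0 < y := hx.1.trans_le hy.1
  rcases (H.fixed y hy1.le).mp hy' with h1 | h1
  · exact hy1.ne' h1
  · linarith [hy.2, H.mem.2]

theorem map_le_peak (H : IsUnimodalContraction g kap xm) {x : ℝ} (hx : 0 ≤ x) : g x ≤ g xm := by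
  rcases le_total x xm with h | h
  · exact H.up.monotoneOn ⟨hx, h⟩ ⟨H.mem.1.le, le_rfl⟩ h
  · exact H.down.antitoneOn self_mem_Ici h h

theorem map_pos (H : IsUnimodalContraction g kap xm) {x : ℝ} (hx : xm ≤ x) : 0 < g x :=
  (H.nonneg (x + 1) (by linarith [H.mem.1])).trans_lt
    (H.down hx (by simp only [mem_Ici]; linarith) (by linarith))

theorem map_ge_endpoint (H : IsUnimodalContraction g kap xm) {m q M : ℝ} (hm : 0 ≤ m)
    (hq : q ∈ Icc m M) : g m ≤ g q ∨ xm ≤ M ∧ g M ≤ g q := by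
  rcases le_total q xm with h | h
  · exact Or.inl (H.up.monotoneOn ⟨hm, hq.1.trans h⟩ ⟨hm.trans hq.1, h⟩ hq.1)
  · exact Or.inr ⟨h.trans hq.2, H.down.antitoneOn h (h.trans hq.2) hq.2⟩

theorem abs_sub_lt (H : IsUnimodalContraction g kap xm) {x y : ℝ} (hx : g (g xm) ≤ x)
    (hxy : x < y) (hy : y ≤ g xm) : |g y - g x| < y - x := by
  obtain ⟨z, hz, hz'⟩ := exists_deriv_eq_slope g hxy H.cont.continuousOn fun z hz =>
    ((H.contr z ⟨hx.trans hz.1.le, hz.2.le.trans hy⟩).1).differentiableWithinAt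
  have h1 := (H.contr z ⟨hx.trans hz.1.le, hz.2.le.trans hy⟩).2
  have h0 : 0 < y - x := sub_pos.mpr hxy
  rw [hz', abs_div, abs_of_pos h0, div_lt_one h0] at h1
  exact h1

/-- The only compact interval of positive numbers contained in its own image is `{κ}`. -/
theorem eq_kap_of_subset_image (H : IsUnimodalContraction g kap xm) {m M p q : ℝ} (hm : 0 < m)
    (hp : p ∈ Icc m M) (hq : q ∈ Icc m M) (hM : M ≤ g p) (hmq : g q ≤ m) :
    m = kap ∧ M = kap := by
  have hmM : m ≤ M := hp.1.trans hp.2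
  have key : kap ≤ m → m = kap ∧ M = kap := fun h => by
    have h1 : g p ≤ g kap := H.down.antitoneOn H.mem.2.le
      (H.mem.2.le.trans (h.trans hp.1)) (h.trans hp.1)
    rw [H.map_kap] at h1
    constructor <;> linarith
  rcases H.map_ge_endpoint hm.le hq with h | ⟨h, h'⟩
  · refine key (not_lt.mp fun hlt => ?_)
    linarith [H.lt_map ⟨hm, hlt⟩]
  · have hMb : M ≤ g xm := hM.trans (H.map_le_peak (hm.le.trans hp.1))
    have hMa : g (g xm) ≤ m := (H.down.antitoneOn h (h.trans hMb) hMb).trans (h'.trans hmq)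
    have hpq : p = q := by
      rcases lt_trichotomy p q with h1 | h1 | h1
      · have := (abs_lt.mp (H.abs_sub_lt (hMa.trans hp.1) h1 (hq.2.trans hMb))).1
        linarith [hp.1, hq.2]
      · exact h1
      · have := (abs_lt.mp (H.abs_sub_lt (hMa.trans hq.1) h1 (hp.2.trans hMb))).2
        linarith [hq.1, hp.2]
    subst hpq
    have hpm : p = m := le_antisymm (by linarith [hp.2]) hp.1
    have hMm : M = m := le_antisymm (by linarith) hmM
    have : g m = m := le_antisymm (hpm ▸ hmq) (by rw [← hpm]; linarith)
    rcases (H.fixed m hm.le).mp this with h1 | h1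
    · exact absurd h1 hm.ne'
    · exact ⟨h1, hMm.trans h1⟩

theorem exists_lower_barrier (H : IsUnimodalContraction g kap xm) {ε₀ : ℝ} (hε₀ : 0 < ε₀) (B : ℝ) :
    ∃ ε > 0, ε ≤ ε₀ ∧ ∀ y, ε ≤ y → y ≤ B → ε ≤ g y := by
  have hB := H.map_pos (le_max_right B xm)
  refine ⟨min ε₀ (min xm (g (max B xm))), lt_min hε₀ (lt_min H.mem.1 hB), min_le_left _ _, ?_⟩
  set ε := min ε₀ (min xm (g (max B xm)))
  have hε : 0 < ε := lt_min hε₀ (lt_min H.mem.1 hB)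
  have hεxm : ε ≤ xm := (min_le_right _ _).trans (min_le_left _ _)
  intro y hy hyB
  rcases H.map_ge_endpoint hε.le ⟨hy, hyB.trans (le_max_left B xm)⟩ with h | ⟨-, h⟩
  · exact (H.lt_map ⟨hε, hεxm.trans_lt H.mem.2⟩).le.trans h
  · exact ((min_le_right _ _).trans (min_le_right _ _)).trans h

end IsUnimodalContraction

namespace IsDelaySol

variable {g : ℝ → ℝ} {h : ℝ} {u v : ℝ → ℝ → ℝ}

/-- Positivity spreads instantaneously: on a later time window the solution is bounded below
ahead of any prescribed position of the moving frame. -/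
theorem exists_pos_lower_bound (hu : IsDelaySol g h u) (hh : 0 < h)
    (hg : ∀ x, 0 ≤ x → 0 ≤ g x) (hu0 : ∀ t ≥ -h, ∀ x, 0 ≤ u t x) {c m X T Z : ℝ} (hc : 0 < c)
    (hm : 0 < m) (hX : ∀ x ≥ X, m ≤ u 0 x) (hT : h + 1 ≤ T) :
    ∃ ε > 0, ∀ t ∈ Icc (T - h) T, ∀ x, Z ≤ x + c * t → ε ≤ u t x := by
  have hT0 : 0 ≤ T := by linarith
  set b := |X| + |Z| + c * T + 1 with hb
  have hbpos : 0 < b := by positivity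
  set K := (1 + b) ^ 2 + 1 with hK
  have hKpos : 0 < K := by positivity
  have hfac : ∀ t x, m * Real.exp (-K * t + 0 * x + 0)
      - 2 * m * Real.exp ((-K - b) * t + -1 * x + X)
      + m * Real.exp ((-K - 2 * b) * t + -2 * x + 2 * X)
      = m * Real.exp (-K * t) * (1 - Real.exp (-(x - X + b * t))) ^ 2 := by
    intro t x
    have e1 : Real.exp ((-K - b) * t + -1 * x + X)
        = Real.exp (-K * t) * Real.exp (-(x - X + b * t)) := by
      rw [← Real.exp_add]; congr 1; ring
    have e2 : Real.exp ((-K - 2 * b) * t + -2 * x + 2 * X)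
        = Real.exp (-K * t) * Real.exp (-(x - X + b * t)) ^ 2 := by
      rw [← Real.exp_nat_mul, ← Real.exp_add]; congr 1; push_cast; ring
    rw [e1, e2, show -K * t + 0 * x + 0 = -K * t by ring]
    ring
  have main : ∀ t ≥ 0, ∀ x, 0 ≤ x - X + b * t →
      m * Real.exp (-K * t) * (1 - Real.exp (-(x - X + b * t))) ^ 2 ≤ u t x := by
    intro t ht x hx
    have hF : IsClosed {p : ℝ × ℝ | 0 ≤ p.2 - X + b * p.1} :=
      isClosed_le continuous_const (by fun_prop)
    have hle : ∀ t ≥ 0, ∀ x, 0 ≤ x - X + b * t →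
        m * Real.exp (-K * t) * (1 - Real.exp (-(x - X + b * t))) ^ 2 ≤ m := by
      intro t ht x hx
      have h1 : Real.exp (-(x - X + b * t)) ≤ 1 := Real.exp_le_one_iff.mpr (by linarith)
      have h2 : Real.exp (-K * t) ≤ 1 := Real.exp_le_one_iff.mpr (by nlinarith)
      have h3 := Real.exp_pos (-(x - X + b * t))
      have h4 : (1 - Real.exp (-(x - X + b * t))) ^ 2 ≤ 1 := by nlinarith
      calc m * Real.exp (-K * t) * (1 - Real.exp (-(x - X + b * t))) ^ 2
          ≤ m * 1 * 1 := by gcongr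
        _ = m := by ring
    have key := parabolic_max_principle
      (D := fun t x => m * Real.exp (-K * t + 0 * x + 0)
        - 2 * m * Real.exp ((-K - b) * t + -1 * x + X)
        + m * Real.exp ((-K - 2 * b) * t + -2 * x + 2 * X) - u t x)
      (T₀ := 0) (T₁ := t) (B := m) hF
      ((Continuous.continuousOn (by fun_prop)).sub (hu.continuousOn_strip hh le_rfl))
      (fun t ht x hx => ?_) ?_ t ⟨ht, le_rfl⟩ x hx
    · rw [hfac] at key
      linarith
    · rw [hfac]
      linarith [hle t ht.1 x hx, hu0 t (by linarith [ht.1]) x]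
    intro t ht x hx hpos
    replace hx : 0 ≤ x - X + b * t := hx
    have hpos' := hpos
    rw [hfac] at hpos'
    have hTt : 0 < t := by
      rcases ht.1.lt_or_eq with h1 | h1
      · exact h1
      · have h2 := hle t ht.1 x hx
        subst h1
        linarith [hX x (by linarith)]
    have hx' : 0 < x - X + b * t := by
      rcases hx.lt_or_eq with h1 | h1
      · exact h1
      · rw [← h1] at hpos'
        simp only [neg_zero, Real.exp_zero] at hpos'
        linarith [hu0 t (by linarith) x]
    obtain ⟨a, b', hjet, hab⟩ := hu.jet t hTt x
    refine ⟨hTt, ?_, _, _, (((HasJet.exp_linear m (-K) 0 0 t x).sub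
      (HasJet.exp_linear (2 * m) (-K - b) (-1) X t x)).add
      (HasJet.exp_linear m (-K - 2 * b) (-2) (2 * X) t x)).sub hjet, ?_⟩
    · have : Continuous fun p : ℝ × ℝ => p.2 - X + b * p.1 := by fun_prop
      exact ((this.tendsto (t, x)).eventually (lt_mem_nhds hx')).mono fun p hp => le_of_lt hp
    have hgu := hg _ (hu0 (t - h) (by linarith) x)
    have e1 : Real.exp ((-K - b) * t + -1 * x + X)
        = Real.exp (-K * t) * Real.exp (-(x - X + b * t)) := by
      rw [← Real.exp_add]; congr 1; ring
    have e2 : Real.exp ((-K - 2 * b) * t + -2 * x + 2 * X)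
        = Real.exp (-K * t) * Real.exp (-(x - X + b * t)) ^ 2 := by
      rw [← Real.exp_nat_mul, ← Real.exp_add]; congr 1; push_cast; ring
    rw [e1, e2, show -K * t + 0 * x + 0 = -K * t by ring]
    set E := Real.exp (-(x - X + b * t))
    have hquad : 0 ≤ (1 + b) ^ 2 * (1 - E) ^ 2 - 2 * (1 + b) * E * (1 - E) + 2 * E ^ 2 := by
      nlinarith [sq_nonneg ((1 + b) * (1 - E) - E), sq_nonneg E]
    have hA : 0 ≤ m * Real.exp (-K * t) *
        ((1 + b) ^ 2 * (1 - E) ^ 2 - 2 * (1 + b) * E * (1 - E) + 2 * E ^ 2) := by positivity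
    rw [hab]
    set A := Real.exp (-K * t)
    have hKA : m * A * ((1 + b) ^ 2 * (1 - E) ^ 2 - 2 * (1 + b) * E * (1 - E) + 2 * E ^ 2) =
        m * A * ((K - 1) - 2 * (K + b) * E + (K + 2 * b + 3) * E ^ 2) := by
      rw [hK]; ring
    rw [hKA] at hA
    linarith
  have hE : Real.exp (-1 : ℝ) < 1 := Real.exp_lt_one_iff.mpr (by norm_num)
  refine ⟨m * Real.exp (-K * T) * (1 - Real.exp (-1)) ^ 2, ?_, fun t ht x hx => ?_⟩
  · have : 0 < 1 - Real.exp (-1 : ℝ) := by linarith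
    positivity
  have hy : 1 ≤ x - X + b * t := by
    have h1 : b * 1 ≤ b * t := mul_le_mul_of_nonneg_left (by linarith [ht.1]) hbpos.le
    have h2 : c * t ≤ c * T := mul_le_mul_of_nonneg_left ht.2 hc.le
    linarith [le_abs_self X, neg_abs_le Z]
  refine le_trans ?_ (main t (by linarith [ht.1]) x (by linarith))
  have h1 : Real.exp (-(x - X + b * t)) ≤ Real.exp (-1) := Real.exp_le_exp.mpr (by linarith)
  have h2 : Real.exp (-K * T) ≤ Real.exp (-K * t) :=
    Real.exp_le_exp.mpr (by nlinarith [ht.2])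
  have h3 : 0 ≤ 1 - Real.exp (-1 : ℝ) := by linarith
  gcongr

/-- A positive lower bound ahead of a moving boundary persists. -/
theorem lower_bound_persists (hu : IsDelaySol g h u) (hh : 0 < h) {c ε T Z : ℝ} (hc : 0 < c)
    (hT : 0 ≤ T)
    (hbase : ∀ t ∈ Icc (T - h) T, ∀ x, Z - c * h ≤ x + c * t → ε ≤ u t x)
    (hbdry : ∀ t ≥ T, ∀ x, x + c * t ∈ Icc (Z - c * h) Z → ε ≤ u t x)
    (hg : ∀ t ≥ T - h, ∀ x, ε ≤ u t x → ε ≤ g (u t x)) :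
    ∀ t ≥ T - h, ∀ x, Z - c * h ≤ x + c * t → ε ≤ u t x := by
  refine delay_induction hh hbase fun T' hT' ih t ht x hx => ?_
  rcases le_or_gt (x + c * t) Z with hZ | hZ
  · exact hbdry t (by linarith [ht.1]) x ⟨hx, hZ⟩
  obtain ⟨M, hM⟩ := hu.bdd (T' + h)
  have hF : IsClosed {p : ℝ × ℝ | Z ≤ p.2 + c * p.1} :=
    isClosed_le continuous_const (by fun_prop)
  have key := parabolic_max_principle (D := fun t x => ε - u t x) (T₀ := T')
    (T₁ := T' + h) (B := ε + M) hF
    (continuousOn_const.sub (hu.continuousOn_strip hh (hT.trans hT')))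
    (fun t ht x _ => by
      have := hM t ⟨by linarith [ht.1], ht.2⟩ x
      linarith [neg_abs_le (u t x)]) ?_ t ht x hZ.le
  · linarith
  intro t ht x hx hpos
  replace hx : Z ≤ x + c * t := hx
  have hch : 0 < c * h := mul_pos hc hh
  have hTt : T' < t := by
    rcases ht.1.lt_or_eq with h1 | h1
    · exact h1
    · have := ih t ⟨by linarith, h1.ge⟩ x (by linarith)
      linarith
  have hx' : Z < x + c * t := by
    rcases hx.lt_or_eq with h1 | h1
    · exact h1
    · have := hbdry t (by linarith) x ⟨by linarith, h1.ge⟩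
      linarith
  obtain ⟨a, b, hjet, hab⟩ := hu.jet t (by linarith) x
  refine ⟨hTt, ?_, _, _, (HasJet.const ε t x).sub hjet, ?_⟩
  · have : Continuous fun p : ℝ × ℝ => p.2 + c * p.1 := by fun_prop
    exact ((this.tendsto (t, x)).eventually (lt_mem_nhds hx')).mono fun p hp => le_of_lt hp
  have := hg (t - h) (by linarith) x (ih (t - h) ⟨by linarith, by linarith [ht.2]⟩ x (by
    rw [mul_sub]; linarith))
  linarith

end IsDelaySol

/-- Joint divergence of time and of the position `x + ct` in the moving frame. -/
def movingFrame (c : ℝ) : Filter (ℝ × ℝ) :=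
  comap (fun p : ℝ × ℝ => min p.1 (p.2 + c * p.1)) atTop

theorem eventually_movingFrame {c : ℝ} {P : ℝ × ℝ → Prop} :
    (∀ᶠ p in movingFrame c, P p) ↔
      ∃ T Z : ℝ, ∀ t ≥ T, ∀ x, Z ≤ x + c * t → P (t, x) := by
  rw [movingFrame, eventually_comap, eventually_atTop]
  constructor
  · rintro ⟨N, hN⟩
    exact ⟨N, N, fun t ht x hx => hN _ (le_min ht hx) (t, x) rfl⟩
  · rintro ⟨T, Z, H⟩
    refine ⟨max T Z, ?_⟩
    rintro N hN ⟨t, x⟩ rfl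
    exact H t ((le_max_left _ _).trans (hN.trans (min_le_left _ _))) x
      ((le_max_right _ _).trans (hN.trans (min_le_right _ _)))

instance movingFrame_neBot (c : ℝ) : (movingFrame c).NeBot := by
  rw [movingFrame]
  refine comap_neBot_iff.mpr fun s hs => ?_
  obtain ⟨N, hN⟩ := mem_atTop_sets.mp hs
  exact ⟨(N, N - c * N), hN _ (le_min le_rfl (by simp))⟩

theorem Filter.Eventually.delay {c h : ℝ} {P : ℝ × ℝ → Prop}
    (H : ∀ᶠ p in movingFrame c, P p) : ∀ᶠ p in movingFrame c, P (p.1 - h, p.2) := by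
  obtain ⟨T, Z, H⟩ := eventually_movingFrame.mp H
  refine eventually_movingFrame.mpr ⟨T + h, Z + c * h, fun t ht x hx => H _ (by linarith) x ?_⟩
  simp only [mul_sub]
  linarith

theorem exists_near_of_mem_enlarged {m M η y : ℝ} (hmM : m ≤ M) (hη : 0 ≤ η)
    (hy : y ∈ Icc (m - η) (M + η)) : ∃ z ∈ Icc m M, |y - z| ≤ η := by
  refine ⟨max m (min y M), ⟨le_max_left _ _, max_le hmM (min_le_right _ _)⟩, ?_⟩
  rw [abs_le]
  rcases max_cases m (min y M) with h1 | h1 <;> rcases min_cases y M with h2 | h2 <;>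
    constructor <;> linarith [hy.1, hy.2]

/-- Solutions that eventually stay away from zero in the moving frame converge to `κ`. -/
theorem IsDelaySol.tendsto_kap {g : ℝ → ℝ} {h kap xm c ε B L : ℝ} {u : ℝ → ℝ → ℝ}
    (hu : IsDelaySol g h u) (H : IsUnimodalContraction g kap xm) (hh : 0 < h) (hc : 0 < c)
    (hL : ∀ x y : ℝ, 0 ≤ x → 0 ≤ y → |g x - g y| ≤ L * |x - y|)
    (hu0 : ∀ t ≥ 0, ∀ x, 0 ≤ u t x) (hB : ∀ t ≥ 0, ∀ x, u t x ≤ B) (hε : 0 < ε)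
    (hlow : ∀ᶠ p in movingFrame c, ε ≤ u p.1 p.2) :
    Tendsto (fun p : ℝ × ℝ => u p.1 p.2) (movingFrame c) (𝓝 kap) := by
  set l := movingFrame c
  set f : ℝ × ℝ → ℝ := fun p => u p.1 p.2 with hf
  have hup : ∀ᶠ p in l, f p ≤ B :=
    eventually_movingFrame.mpr ⟨0, 0, fun t ht x _ => hB t ht x⟩
  have hba : l.IsBoundedUnder (· ≤ ·) f := ⟨B, by simpa using hup⟩
  have hbb : l.IsBoundedUnder (· ≥ ·) f := ⟨ε, by simpa using hlow⟩
  set M := limsup f l with hM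
  set m := liminf f l with hm
  have hmM : m ≤ M := liminf_le_limsup hba hbb
  have hm0 : 0 < m := hε.trans_le (le_liminf_of_le hba.isCoboundedUnder_ge hlow)
  have hL0 : 0 ≤ L := by
    have := (abs_nonneg _).trans (hL 1 0 zero_le_one le_rfl)
    simpa using this
  have hnear : ∀ η > 0, ∀ᶠ p in l, ∃ z ∈ Icc m M, |g (u (p.1 - h) p.2) - g z| ≤ L * η := by
    intro η hη
    have h1 := eventually_lt_of_limsup_lt (show limsup f l < M + η by linarith) hba
    have h2 := eventually_lt_of_lt_liminf (show m - η < liminf f l by linarith) hbb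
    filter_upwards [(h1.and (h2.and hlow)).delay (h := h)] with p hp
    obtain ⟨z, hz, hyz⟩ := exists_near_of_mem_enlarged hmM hη.le ⟨hp.2.1.le, hp.1.le⟩
    exact ⟨z, hz, (hL _ _ (hε.le.trans hp.2.2) (hm0.le.trans hz.1)).trans
      (mul_le_mul_of_nonneg_left hyz hL0)⟩
  obtain ⟨p, hp, hpmax⟩ := (isCompact_Icc (a := m) (b := M)).exists_isMaxOn ⟨m, le_rfl, hmM⟩
    H.cont.continuousOn
  obtain ⟨q, hq, hqmin⟩ := (isCompact_Icc (a := m) (b := M)).exists_isMinOn ⟨m, le_rfl, hmM⟩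
    H.cont.continuousOn
  have hscale : ∀ η > 0, L * (η / (L + 1)) + η / (L + 1) = η := fun η _ => by
    field_simp
  have hMp : M ≤ g p := by
    refine le_of_forall_pos_le_add fun η hη => ?_
    have hη' : 0 < η / (L + 1) := by positivity
    obtain ⟨T, Z, hTZ⟩ := eventually_movingFrame.mp (hnear _ hη')
    obtain ⟨T', Z', hT'⟩ := hu.eventually_le_of_forcing hh (G := g p + L * (η / (L + 1)))
      hc hB hη' (fun t ht x hx => by
        obtain ⟨z, hz, hz'⟩ := hTZ t ht x hx
        have h1 : g z ≤ g p := hpmax hz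
        linarith [(abs_le.mp hz').2])
    refine limsup_le_of_le hbb.isCoboundedUnder_le
      (eventually_movingFrame.mpr ⟨T', Z', fun t ht x hx => ?_⟩)
    linarith [hT' t ht x hx, hscale η hη]
  have hmq : g q ≤ m := by
    refine le_of_forall_pos_le_add fun η hη => ?_
    have hη' : 0 < η / (L + 1) := by positivity
    obtain ⟨T, Z, hTZ⟩ := eventually_movingFrame.mp (hnear _ hη')
    obtain ⟨T', Z', hT'⟩ := hu.neg.eventually_le_of_forcing hh (B := 0)
      (G := -g q + L * (η / (L + 1))) hc (fun t ht x => by linarith [hu0 t ht x]) hη'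
      (fun t ht x hx => by
        obtain ⟨z, hz, hz'⟩ := hTZ t ht x hx
        have h1 : g q ≤ g z := hqmin hz
        simp only [neg_neg]
        linarith [(abs_le.mp hz').1])
    have : g q - η ≤ m := le_liminf_of_le hba.isCoboundedUnder_ge
      (eventually_movingFrame.mpr ⟨T', Z', fun t ht x hx => by
        linarith [hT' t ht x hx, hscale η hη]⟩)
    linarith
  obtain ⟨h1, h2⟩ := H.eq_kap_of_subset_image hm0 hp hq hMp hmq
  exact tendsto_of_liminf_eq_limsup h1 h2 hba hbb

theorem chi_neg_of_between {g0 c h lam1 lam2 lam : ℝ} (hg0 : 0 ≤ g0)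
    (h1 : chi g0 c h lam1 = 0) (h2 : chi g0 c h lam2 = 0) (hlam : lam ∈ Ioo lam1 lam2) :
    chi g0 c h lam < 0 := by
  obtain ⟨hl, hr⟩ := hlam
  have hd : 0 < lam2 - lam1 := by linarith
  set s := (lam2 - lam) / (lam2 - lam1) with hs
  set r := (lam - lam1) / (lam2 - lam1) with hr'
  have hs0 : 0 < s := div_pos (by linarith) hd
  have hr0 : 0 < r := div_pos (by linarith) hd
  have hsum : s + r = 1 := by rw [hs, hr']; field_simp; ring
  have hcomb : s * lam1 + r * lam2 = lam := by rw [hs, hr']; field_simp; ring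
  have hexp := convexOn_exp.2 (mem_univ (-(lam1 * c * h))) (mem_univ (-(lam2 * c * h)))
    hs0.le hr0.le hsum
  simp only [smul_eq_mul] at hexp
  rw [show s * -(lam1 * c * h) + r * -(lam2 * c * h) = -(lam * c * h) by rw [← hcomb]; ring] at hexp
  have hsq : lam ^ 2 < s * lam1 ^ 2 + r * lam2 ^ 2 := by
    have hid : s * lam1 ^ 2 + r * lam2 ^ 2 - lam ^ 2 = s * r * (lam2 - lam1) ^ 2 := by
      rw [← hcomb, show s = 1 - r by linarith]; ring
    have : 0 < s * r * (lam2 - lam1) ^ 2 := by positivity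
    linarith
  have hmul := mul_le_mul_of_nonneg_left hexp hg0
  have hsum1 : s * chi g0 c h lam1 + r * chi g0 c h lam2 = 0 := by rw [h1, h2]; ring
  unfold chi at *
  have hlin : c * lam = s * (c * lam1) + r * (c * lam2) := by rw [← hcomb]; ring
  linarith

theorem exists_decay_rate {a b h : ℝ} (hab : a < b) :
    ∀ᶠ γ in 𝓝[>] (0 : ℝ), a * Real.exp (γ * h) + γ < b := by
  have hc : Continuous fun γ : ℝ => a * Real.exp (γ * h) + γ := by fun_prop
  have := hc.tendsto 0
  simp only [zero_mul, Real.exp_zero, mul_one, add_zero] at this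
  exact (this.mono_left nhdsWithin_le_nhds).eventually (gt_mem_nhds hab)

theorem exists_contraction_near {g : ℝ → ℝ} {kap : ℝ} (hg : ContDiffAt ℝ 1 g kap)
    (hd : |deriv g kap| < 1) :
    ∃ K, 0 ≤ K ∧ K < 1 ∧ ∃ δ > 0, ∀ x y, |x - kap| < δ → |y - kap| < δ →
      |g x - g y| ≤ K * |x - y| := by
  obtain ⟨K, hK1, hK2⟩ := exists_between hd
  have hK0 : 0 ≤ K := (abs_nonneg _).trans hK1.le
  obtain ⟨s, hs, hLip⟩ := HasStrictFDerivAt.exists_lipschitzOnWith_of_nnnorm_lt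
    (hg.hasStrictDerivAt one_ne_zero)
    (K := K.toNNReal) (by
      rw [← NNReal.coe_lt_coe, Real.coe_toNNReal K hK0]
      simpa using hK1)
  obtain ⟨δ, hδ, hball⟩ := Metric.mem_nhds_iff.mp hs
  refine ⟨K, hK0, hK2, δ, hδ, fun x y hx hy => ?_⟩
  have := hLip.dist_le_mul x (hball (by simpa [Real.dist_eq] using hx)) y
    (hball (by simpa [Real.dist_eq] using hy))
  simpa [Real.dist_eq, hK0] using this

/-- **Corollary 3 (global stability for unimodal birth functions).**
Under (UM) with a unimodal `g` (unique local extremum, a maximum, at `x_m ∈ (0,κ)`)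
satisfying `|g'| < 1` on `[g(g(x_m)), g(x_m)]`, any solution with (IC1), (IC2)
initial datum whose `|·|_λ` distance to a semi-wavefront is finite converges to it;
in particular the semi-wavefront is a wavefront. -/
theorem unimodal_global_stability
    (g : ℝ → ℝ) (kap del0 Lg h c : ℝ)
    -- (UM): (H), L_g = g'(0), g bounded
    (hH : HypH g kap del0 Lg) (hLg : Lg = deriv g 0)
    (hbdd : ∃ M : ℝ, ∀ x : ℝ, 0 ≤ x → g x ≤ M)
    (hh : 0 < h) (hc : 0 < c)
    -- g unimodal with a unique local extremum (a maximum) at x_m ∈ (0,κ)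
    (xm : ℝ) (hxm : xm ∈ Set.Ioo 0 kap)
    (hup : StrictMonoOn g (Set.Icc 0 xm)) (hdown : StrictAntiOn g (Set.Ici xm))
    -- |g'(x)| < 1 for all x ∈ [g(g(x_m)), g(x_m)]
    (hg' : ∀ x ∈ Set.Icc (g (g xm)) (g xm),
        DifferentiableAt ℝ g x ∧ |deriv g x| < 1)
    (w0 : ℝ → ℝ → ℝ) (hIC1 : IC1 h w0) (hIC2 : IC2 h w0) (hHol : LocHolder h w0)
    -- c > c_# : χ₀(·;c) has two distinct positive real zeros λ₁ < λ₂
    (lam1 lam2 : ℝ) (hlam1_pos : 0 < lam1) (hlam_lt : lam1 < lam2)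
    (hchi1 : chi (deriv g 0) c h lam1 = 0) (hchi2 : chi (deriv g 0) c h lam2 = 0)
    (lam : ℝ) (hlam : lam ∈ Set.Ioo lam1 lam2)
    (φ : ℝ → ℝ) (hφ : IsSemiWavefront g h c φ)
    -- sup_{s∈[−h,0]} |φ(·+cs) − w₀(s,·)|_λ < ∞
    (hpert : ∃ M : ℝ, ∀ s ∈ Set.Icc (-h) 0, ∀ x : ℝ,
        |φ (x + c * s) - w0 s x| ≤ M * eta lam x)
    -- u : a classical solution of (*) with initial datum w₀
    (u : ℝ → ℝ → ℝ) (hu : SolvesStar g h u)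
    (hinit : ∀ s ∈ Set.Icc (-h) 0, ∀ x : ℝ, u s x = w0 s x) :
    Filter.Tendsto φ Filter.atTop (nhds kap) ∧
    ∃ ρ > (0:ℝ), ∃ γ > (0:ℝ), ∀ t ≥ (0:ℝ), ∀ x : ℝ,
      |u t x - φ (x + c * t)| ≤ 0.5 * ρ * Real.exp (-(γ * t)) * eta lam (x + c * t) := by
  have H : IsUnimodalContraction g kap xm :=
    ⟨hH.cont, hH.nonneg, hH.fixed_points, hxm, hup, hdown, hg'⟩
  have hus := hu.isDelaySol
  have hvs := hφ.isDelaySol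
  obtain ⟨hφpos, ⟨Mφ, hMφ⟩, -, -, -, m₀, hm₀, hφm⟩ := hφ
  obtain ⟨Z₀, hZ₀⟩ := eventually_atTop.mp hφm
  obtain ⟨M₀, hM₀⟩ := hIC1
  obtain ⟨m₁, hm₁, X, hX⟩ := hIC2
  obtain ⟨M, hM⟩ := hpert
  have hlip := hH.lipschitz
  rw [hLg] at hlip
  set L := deriv g 0 with hL
  have hL0 : 0 ≤ L := by linarith [hH.deriv0_gt]
  have hinit0 : (0 : ℝ) ∈ Icc (-h) 0 := ⟨by linarith, le_rfl⟩
  have hu0 : ∀ t ≥ -h, ∀ x, 0 ≤ u t x := hus.nonneg hh hH.nonneg fun t ht x => by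
    rw [hinit t ht x]; exact (hM₀ t ht x).1
  set B := max M₀ (g xm) with hB
  have huB : ∀ t ≥ 0, ∀ x, u t x ≤ B := hus.le_of_forcing_le hh
    (fun t ht x => (H.map_le_peak (hu0 _ (by linarith) x)).trans (le_max_right _ _))
    (fun x => by rw [hinit 0 hinit0 x]; exact (hM₀ 0 hinit0 x).2.trans (le_max_left _ _))
  have hchi : chi L c h lam < 0 := chi_neg_of_between hL0 hchi1 hchi2 hlam
  have hlam0 : 0 < lam := hlam1_pos.trans hlam.1
  obtain ⟨K, hK0, hK1, δ, hδ, hcontr⟩ := exists_contraction_near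
    (hH.smooth_kap.contDiffAt (Ioo_mem_nhds (by linarith [hH.del0_pos]) (by linarith [hH.del0_pos])))
    (hg' kap ⟨by
      have := H.down.antitoneOn hxm.2.le (hxm.2.le.trans (H.map_kap ▸ H.map_le_peak hH.kap_pos.le))
        (H.map_kap ▸ H.map_le_peak hH.kap_pos.le)
      rwa [H.map_kap] at this, H.map_kap ▸ H.map_le_peak hH.kap_pos.le⟩).2
  have hrate : L * Real.exp (-(lam * c * h)) < 1 + lam * c - lam ^ 2 := by
    unfold chi at hchi; linarith
  obtain ⟨γ, ⟨hγ1, hγ2⟩, hγ⟩ := (((exists_decay_rate (h := h) hrate).and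
    (exists_decay_rate (h := h) hK1)).and self_mem_nhdsWithin).exists
  replace hγ : 0 < γ := hγ
  -- weighted estimate on the whole line
  set p := lam * c - γ with hp
  obtain ⟨M₁, hM₁⟩ : ∃ M₁, M₁ = |M| * Real.exp (|p| * h) := ⟨_, rfl⟩
  have hM₁0 : 0 ≤ M₁ := by rw [hM₁]; positivity
  have hweight : ∀ t ≥ -h, ∀ x, |u t x - φ (x + c * t)| ≤ M₁ * Real.exp (p * t + lam * x) := by
    have := hus.abs_sub_le_exp hvs hh (p := p) (q := lam) (T := 0) le_rfl hM₁0 hL0 (by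
        rw [show -(p * h) = -(lam * c * h) + γ * h by rw [hp]; ring, Real.exp_add, ← mul_assoc]
        linarith)
      (fun t ht x => Or.inr (hlip _ _ (hu0 _ (by linarith) x) (hφpos _).le))
      (fun t ht x => ?_)
    · simpa using this
    rw [zero_sub] at ht
    rw [abs_sub_comm, hinit t ht x]
    calc |φ (x + c * t) - w0 t x| ≤ M * eta lam x := hM t ht x
      _ ≤ |M| * Real.exp (lam * x) := by
        have h1 : 0 ≤ eta lam x := le_min (Real.exp_pos _).le zero_le_one
        exact (mul_le_mul_of_nonneg_right (le_abs_self M) h1).trans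
          (mul_le_mul_of_nonneg_left (min_le_left _ _) (abs_nonneg M))
      _ ≤ |M| * Real.exp (|p| * h + (p * t + lam * x)) := by
        refine mul_le_mul_of_nonneg_left (Real.exp_le_exp.mpr ?_) (abs_nonneg M)
        have h1 : |p * t| ≤ |p| * h := by
          rw [abs_mul]
          exact mul_le_mul_of_nonneg_left (abs_le.mpr ⟨ht.1, by linarith [ht.2]⟩) (abs_nonneg p)
        linarith [neg_abs_le (p * t)]
      _ = M₁ * Real.exp (p * t + lam * x) := by rw [hM₁, Real.exp_add]; ring
  have hweight' : ∀ t ≥ -h, ∀ x Z, x + c * t ≤ Z →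
      |u t x - φ (x + c * t)| ≤ M₁ * Real.exp (lam * Z) * Real.exp (-γ * t) := by
    intro t ht x Z hxZ
    refine (hweight t ht x).trans ?_
    rw [mul_assoc, ← Real.exp_add]
    refine mul_le_mul_of_nonneg_left (Real.exp_le_exp.mpr ?_) hM₁0
    have := mul_le_mul_of_nonneg_left hxZ hlam0.le
    rw [hp]
    linarith
  -- persistence ahead of the front
  set Z₁ := Z₀ + c * h with hZ₁
  have hdecay : Tendsto (fun t => M₁ * Real.exp (lam * Z₁) * Real.exp (-γ * t)) atTop (𝓝 0) := by
    have h1 : Tendsto (fun t : ℝ => -γ * t) atTop atBot :=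
      tendsto_id.const_mul_atTop_of_neg (by linarith)
    simpa using (Real.tendsto_exp_atBot.comp h1).const_mul (M₁ * Real.exp (lam * Z₁))
  obtain ⟨T₁, hT₁⟩ := eventually_atTop.mp (hdecay.eventually (gt_mem_nhds (half_pos hm₀)))
  set T := max T₁ (h + 1) with hT
  obtain ⟨ε₀, hε₀, hbase⟩ := hus.exists_pos_lower_bound hh hH.nonneg hu0 hc hm₁
    (fun x hx => by rw [hinit 0 hinit0 x]; exact hX x hx 0 hinit0) (le_max_right T₁ (h + 1))
    (Z := Z₁ - c * h)
  obtain ⟨ε, hε, hεle, hεg⟩ := H.exists_lower_barrier (lt_min hε₀ (half_pos hm₀)) B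
  have hTh : h + 1 ≤ T := le_max_right _ _
  have hpers := hus.lower_bound_persists hh hc (by linarith)
    (fun t ht x hx => (hεle.trans (min_le_left _ _)).trans (hbase t ht x hx))
    (fun t ht x hx => by
      have h1 := hweight' t (by linarith) x Z₁ hx.2
      have h2 := hT₁ t ((le_max_left _ _).trans ht)
      have h3 : m₀ ≤ φ (x + c * t) := hZ₀ _ (by linarith [hx.1])
      linarith [(abs_le.mp h1).1, hεle.trans (min_le_right _ _)])
    (fun t ht x hx => hεg _ hx (huB t (by linarith) x))
  have hulim := hus.tendsto_kap H hh hc hlip (fun t ht x => hu0 t (by linarith) x) huB hε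
    (eventually_movingFrame.mpr ⟨T - h, Z₁ - c * h, hpers⟩)
  have hvlim := hvs.tendsto_kap H hh hc hlip (fun t _ x => (hφpos _).le) (fun t _ x => hMφ _) hm₀
    (eventually_movingFrame.mpr ⟨0, Z₀, fun t _ x hx => hZ₀ _ hx⟩)
  refine ⟨?_, ?_⟩
  · rw [tendsto_def] at hvlim ⊢
    intro s hs
    obtain ⟨T', Z', hTZ⟩ := eventually_movingFrame.mp (hvlim s hs)
    refine mem_atTop_sets.mpr ⟨Z', fun z hz => ?_⟩
    have := hTZ T' le_rfl (z - c * T') (by linarith)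
    simpa using this
  -- contraction near the positive equilibrium
  have hnear : ∀ᶠ q in movingFrame c, |u q.1 q.2 - kap| < δ ∧ |φ (q.2 + c * q.1) - kap| < δ := by
    simpa [Real.dist_eq] using (hulim.eventually (Metric.ball_mem_nhds kap hδ)).and
      (hvlim.eventually (Metric.ball_mem_nhds kap hδ))
  obtain ⟨T₂, Z₂, hTZ⟩ := eventually_movingFrame.mp (hnear.delay (h := h))
  set T₃ := max T₂ h with hT₃
  have hT₃h : h ≤ T₃ := le_max_right _ _
  obtain ⟨A, hA⟩ : ∃ A, A = B + Mφ := ⟨_, rfl⟩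
  have hA0 : 0 ≤ A := by
    have h1 := (hu0 0 (by linarith) 0).trans (huB 0 le_rfl 0)
    linarith [(hφpos 0).trans_le (hMφ 0)]
  have hAbd : ∀ t ≥ 0, ∀ x, |u t x - φ (x + c * t)| ≤ A := by
    intro t ht x
    have h1 := hu0 t (by linarith) x
    have h2 := huB t ht x
    have h3 := hφpos (x + c * t)
    have h4 := hMφ (x + c * t)
    exact abs_le.mpr ⟨by linarith, by linarith⟩
  set M₂ := max (M₁ * Real.exp (lam * Z₂)) (A * Real.exp (γ * T₃)) with hM₂
  have hM₂0 : 0 ≤ M₂ := (show 0 ≤ A * Real.exp (γ * T₃) by positivity).trans (le_max_right _ _)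
  have hearly : ∀ t ∈ Icc 0 T₃, ∀ x, |u t x - φ (x + c * t)| ≤ M₂ * Real.exp (-γ * t) := by
    intro t ht x
    calc |u t x - φ (x + c * t)| ≤ A := hAbd t ht.1 x
      _ ≤ A * Real.exp (γ * T₃) * Real.exp (-γ * t) := by
        rw [mul_assoc, ← Real.exp_add]
        exact le_mul_of_one_le_right hA0 (Real.one_le_exp (by nlinarith [ht.2]))
      _ ≤ M₂ * Real.exp (-γ * t) := by gcongr; exact le_max_right _ _
  have hfinal := hus.abs_sub_le_exp hvs hh (p := -γ) (q := 0) (T := T₃) (by linarith) hM₂0 hK0 (by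
      rw [show -(-γ * h) = γ * h by ring]
      linarith)
    (fun t ht x => by
      rcases le_total (x + c * t) Z₂ with h1 | h1
      · left
        refine (hweight' t (by linarith) x Z₂ h1).trans ?_
        rw [zero_mul, add_zero]
        gcongr
        exact le_max_left _ _
      · right
        obtain ⟨h2, h3⟩ := hTZ t ((le_max_left _ _).trans ht) x h1
        exact hcontr _ _ h2 h3)
    (fun t ht x => by simpa using hearly t ⟨by linarith [ht.1], ht.2⟩ x)
  have huniform : ∀ t ≥ 0, ∀ x, |u t x - φ (x + c * t)| ≤ M₂ * Real.exp (-γ * t) := by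
    intro t ht x
    rcases le_total t T₃ with h1 | h1
    · exact hearly t ⟨ht, h1⟩ x
    · simpa using hfinal t (by linarith) x
  have hρ : 0 < 2 * (max M₁ M₂ + 1) := by linarith [hM₁0.trans (le_max_left M₁ M₂)]
  refine ⟨2 * (max M₁ M₂ + 1), hρ, γ, hγ, fun t ht x => ?_⟩
  rw [show (0.5 : ℝ) * (2 * (max M₁ M₂ + 1)) = max M₁ M₂ + 1 by ring,
    show -(γ * t) = -γ * t by ring, eta]
  have hE := Real.exp_pos (-γ * t)
  rcases min_choice (Real.exp (lam * (x + c * t))) 1 with h1 | h1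
  · rw [h1]
    refine (hweight t (by linarith) x).trans ?_
    rw [mul_assoc, ← Real.exp_add,
      show p * t + lam * x = -γ * t + lam * (x + c * t) by rw [hp]; ring]
    gcongr
    linarith [le_max_left M₁ M₂]
  · rw [h1, mul_one]
    refine (huniform t ht x).trans ?_
    gcongr
    linarith [le_max_right M₁ M₂]
end
end

section
/- Assume (H). Then for every q* > 0 and every q_* ∈ (0,κ) there exist δ* ∈ (0,δ₀) and γ* > 0 such that: (gg1) g(u) − g(u − q e^{γh}) ≤ q(1 − 2γ) for all (u,q,γ) ∈ [κ−δ*, κ] × [0, q_*] × [0, γ*]; and (gg) g(u) − g(u + q e^{γh}) ≥ −q(1 − 2γ) for all (u,q,γ) ∈ [κ−δ*, κ] × [0, q*] × [0, γ*]. -/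
open Set Filter

noncomputable section

/-- Near a point where the strict derivative is less than `1`, the map `x ↦ x - g x` is
strongly monotone, with a uniform constant. -/
theorem eventually_strongly_monotone_sub {g : ℝ → ℝ} {k m : ℝ}
    (hg : HasStrictDerivAt g m k) (hm : m < 1) :
    ∀ᶠ p : ℝ × ℝ in nhds (k, k),
      (1 - m) / 2 * (p.2 - p.1) ^ 2 ≤ (p.2 - p.1) * ((p.2 - g p.2) - (p.1 - g p.1)) := by
  filter_upwards [hg.hasStrictFDerivAt.isLittleO.def (show 0 < (1 - m) / 2 by linarith)]
    with p hp
  simp only [Real.norm_eq_abs, ContinuousLinearMap.toSpanSingleton_apply, smul_eq_mul] at hp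
  have h1 := mul_le_mul_of_nonneg_left hp (abs_nonneg (p.1 - p.2))
  have h2 := le_abs_self ((p.1 - p.2) * (g p.1 - g p.2 - (p.1 - p.2) * m))
  rw [abs_mul] at h2
  nlinarith [abs_mul_abs_self (p.1 - p.2)]

/-- A continuous function without zeros on a preconnected set has constant sign there. -/
theorem IsPreconnected.pos_of_ne_zero {s : Set ℝ} (hs : IsPreconnected s) {f : ℝ → ℝ}
    (hf : ContinuousOn f s) (h0 : ∀ x ∈ s, f x ≠ 0) {w : ℝ} (hw : w ∈ s) (hpos : 0 < f w)
    {v : ℝ} (hv : v ∈ s) : 0 < f v := by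
  by_contra hneg
  obtain ⟨x, hx, hx0⟩ := hs.intermediate_value hv hw hf ⟨not_lt.1 hneg, hpos.le⟩
  exact h0 x hx hx0

theorem HypH.hasStrictDerivAt_kap {g : ℝ → ℝ} {kap del0 Lg : ℝ} (hH : HypH g kap del0 Lg) :
    HasStrictDerivAt g (deriv g kap) kap :=
  (hH.smooth_kap.contDiffAt (Ioo_mem_nhds (by linarith [hH.del0_pos])
    (by linarith [hH.del0_pos]))).hasStrictDerivAt one_ne_zero

theorem HypH.sub_mul_pos {g : ℝ → ℝ} {kap del0 Lg : ℝ} (hH : HypH g kap del0 Lg)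
    {v : ℝ} (hv : 0 < v) (hne : v ≠ kap) : 0 < (v - kap) * (v - g v) := by
  have hfix : g kap = kap := (hH.fixed_points kap hH.kap_pos.le).2 (Or.inr rfl)
  have hlt := hH.deriv_kap_lt
  have hzero : ∀ x : ℝ, 0 < x → x ≠ kap → (x - kap) * (x - g x) ≠ 0 := by
    intro x hx hxk
    refine mul_ne_zero (sub_ne_zero.2 hxk) fun h => ?_
    rcases (hH.fixed_points x hx.le).1 (by linarith) with h | h
    · exact hx.ne' h
    · exact hxk h
  have hcont : Continuous fun x : ℝ => (x - kap) * (x - g x) := by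
    have := hH.cont
    fun_prop
  have hnear : ∀ᶠ x in nhds kap, x ≠ kap → 0 < (x - kap) * (x - g x) := by
    have ht : Tendsto (fun x : ℝ => (kap, x)) (nhds kap) (nhds (kap, kap)) :=
      (Continuous.prodMk_right kap).tendsto kap
    filter_upwards [ht.eventually (eventually_strongly_monotone_sub hH.hasStrictDerivAt_kap hlt)]
      with x hx hxk
    simp only [hfix, sub_self, sub_zero] at hx
    have : 0 < (x - kap) ^ 2 := by
      have := sub_ne_zero.2 hxk
      positivity
    nlinarith
  rcases lt_or_gt_of_ne hne with hlk | hlk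
  · obtain ⟨w, hw, hwI⟩ := ((hnear.filter_mono nhdsWithin_le_nhds).and
      (Ioo_mem_nhdsLT hH.kap_pos)).exists
    exact isPreconnected_Ioo.pos_of_ne_zero hcont.continuousOn
      (fun x hx => hzero x hx.1 hx.2.ne) hwI (hw hwI.2.ne) ⟨hv, hlk⟩
  · obtain ⟨w, hw, hwI⟩ := ((hnear.filter_mono nhdsWithin_le_nhds).and
      (self_mem_nhdsWithin : Ioi kap ∈ nhdsWithin kap (Ioi kap))).exists
    exact isPreconnected_Ioi.pos_of_ne_zero hcont.continuousOn
      (fun x hx => hzero x (hH.kap_pos.trans hx) (ne_of_gt hx)) hwI (hw (ne_of_gt hwI)) hlk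

/-- Strong monotonicity of `x ↦ x - g x` between points near `kap` and points of a compact
set of positive numbers. -/
theorem HypH.eventually_strongly_monotone {g : ℝ → ℝ} {kap del0 Lg : ℝ}
    (hH : HypH g kap del0 Lg) {K : Set ℝ} (hK : IsCompact K) (hpos : ∀ v ∈ K, 0 < v) :
    ∀ᶠ p : ℝ × ℝ in nhds (kap, 0), ∀ v ∈ K,
      p.2 * (v - p.1) ^ 2 ≤ (v - p.1) * ((v - g v) - (p.1 - g p.1)) := by
  have hfix : g kap = kap := (hH.fixed_points kap hH.kap_pos.le).2 (Or.inr rfl)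
  have hlt := hH.deriv_kap_lt
  refine hK.eventually_forall_of_forall_eventually fun v hv => ?_
  rcases eq_or_ne v kap with rfl | hne
  · have ht : Tendsto (fun z : (ℝ × ℝ) × ℝ => (z.1.1, z.2)) (nhds ((v, 0), v))
        (nhds (v, v)) := Continuous.tendsto' (by fun_prop) _ _ rfl
    have he : ∀ᶠ z : (ℝ × ℝ) × ℝ in nhds ((v, 0), v), z.1.2 < (1 - deriv g v) / 2 :=
      (Continuous.tendsto' (by fun_prop) _ _ rfl).eventually_lt_const
        (show (0 : ℝ) < (1 - deriv g v) / 2 by linarith)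
    filter_upwards [he,
      ht.eventually (eventually_strongly_monotone_sub hH.hasStrictDerivAt_kap hlt)] with z h1 h2
    exact (mul_le_mul_of_nonneg_right h1.le (sq_nonneg _)).trans h2
  · have hg := hH.cont
    have hc : Continuous fun z : (ℝ × ℝ) × ℝ =>
        (z.2 - z.1.1) * ((z.2 - g z.2) - (z.1.1 - g z.1.1)) - z.1.2 * (z.2 - z.1.1) ^ 2 := by
      fun_prop
    have := hc.tendsto ((kap, 0), v) |>.eventually_const_lt (u := 0)
      (by simpa [hfix] using hH.sub_mul_pos (hpos v hv) hne)
    filter_upwards [this] with z hz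
    linarith

/-- **The basic inequalities (gg1) and (gg) near the positive equilibrium κ.**
Under (H), for every `q* > 0` and `q_* ∈ (0,κ)` there are `δ* ∈ (0,δ₀)` and `γ* > 0`
such that `g(u) − g(u − qe^{γh}) ≤ q(1−2γ)` on `[κ−δ*,κ]×[0,q_*]×[0,γ*]` and
`g(u) − g(u + qe^{γh}) ≥ −q(1−2γ)` on `[κ−δ*,κ]×[0,q*]×[0,γ*]`. -/
theorem gg_inequalities
    (g : ℝ → ℝ) (kap del0 Lg h : ℝ)
    (hH : HypH g kap del0 Lg) (hh : 0 < h)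
    (qstar qlow : ℝ) (hqstar : 0 < qstar) (hqlow : qlow ∈ Set.Ioo 0 kap) :
    ∃ dstar ∈ Set.Ioo (0:ℝ) del0, ∃ gstar > (0:ℝ),
      (∀ u ∈ Set.Icc (kap - dstar) kap, ∀ q ∈ Set.Icc (0:ℝ) qlow,
        ∀ γ ∈ Set.Icc (0:ℝ) gstar,
          g u - g (u - q * Real.exp (γ * h)) ≤ q * (1 - 2 * γ)) ∧
      (∀ u ∈ Set.Icc (kap - dstar) kap, ∀ q ∈ Set.Icc (0:ℝ) qstar,
        ∀ γ ∈ Set.Icc (0:ℝ) gstar,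
          -(q * (1 - 2 * γ)) ≤ g u - g (u + q * Real.exp (γ * h))) := by
  have hk := hH.kap_pos
  obtain ⟨hq0, hqk⟩ := hqlow
  set K : Set ℝ := Icc ((kap - qlow) / 2) (kap + 2 * qstar) with hKdef
  obtain ⟨η, hη, hball⟩ := Metric.eventually_nhds_iff.1
    (hH.eventually_strongly_monotone (K := K) isCompact_Icc
      fun v hv => lt_of_lt_of_le (by linarith) hv.1)
  have hmono : ∀ u, |u - kap| < η → ∀ v ∈ K,
      η / 2 * (v - u) ^ 2 ≤ (v - u) * ((v - g v) - (u - g u)) := fun u hu =>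
    @hball (u, η / 2) (by
      rw [Prod.dist_eq, Real.dist_eq, Real.dist_eq, sub_zero, abs_of_pos (half_pos hη)]
      exact max_lt hu (half_lt_self hη))
  have hexp : ∀ᶠ γ in nhds (0 : ℝ), (1 - η / 2) * Real.exp (γ * h) - (1 - 2 * γ) < 0 ∧
      Real.exp (γ * h) < 2 ∧ qlow * Real.exp (γ * h) < qlow + (kap - qlow) / 4 := by
    refine ((Continuous.tendsto' (by fun_prop) _ _ rfl).eventually_lt_const ?_).and
      (((Continuous.tendsto' (by fun_prop) _ _ rfl).eventually_lt_const ?_).and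
        ((Continuous.tendsto' (by fun_prop) _ _ rfl).eventually_lt_const ?_)) <;>
    simp <;> linarith
  obtain ⟨ρ, hρ, hexp⟩ := Metric.eventually_nhds_iff.1 hexp
  obtain ⟨d, hd0, hd⟩ := exists_between
    (lt_min hH.del0_pos (lt_min hη (show 0 < (kap - qlow) / 4 by linarith)))
  obtain ⟨hd1, hd⟩ := lt_min_iff.1 hd
  obtain ⟨hd2, hd3⟩ := lt_min_iff.1 hd
  have hγ : ∀ γ ∈ Icc (0 : ℝ) (ρ / 2), (1 - η / 2) * Real.exp (γ * h) - (1 - 2 * γ) < 0 ∧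
      Real.exp (γ * h) < 2 ∧ qlow * Real.exp (γ * h) < qlow + (kap - qlow) / 4 := by
    intro γ hγ
    refine hexp ?_
    rw [Real.dist_eq, sub_zero, abs_of_nonneg hγ.1]
    linarith [hγ.2]
  refine ⟨d, ⟨hd0, hd1⟩, ρ / 2, half_pos hρ, ?_, ?_⟩
  all_goals
    intro u hu q hq γ hγm
    obtain ⟨he1, he2, he3⟩ := hγ γ hγm
    obtain ⟨hu1, hu2⟩ := hu
    have hE := Real.exp_pos (γ * h)
    have huk : |u - kap| < η := by rw [abs_lt]; constructor <;> linarith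
    rcases hq.1.eq_or_lt with rfl | hqpos
    · simp
    have hr : 0 < q * Real.exp (γ * h) := mul_pos hqpos hE
    have hscale := mul_le_mul_of_nonneg_left he1.le hqpos.le
  · have hle := mul_le_mul_of_nonneg_right hq.2 hE.le
    have := hmono u huk (u - q * Real.exp (γ * h)) ⟨by linarith, by linarith⟩
    have : η / 2 * (q * Real.exp (γ * h)) ≤
        q * Real.exp (γ * h) - (g u - g (u - q * Real.exp (γ * h))) :=
      le_of_mul_le_mul_left (by linarith) hr
    linarith
  · have hle := mul_le_mul_of_nonneg_right hq.2 hE.le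
    have h2 := mul_le_mul_of_nonneg_left he2.le hqstar.le
    have := hmono u huk (u + q * Real.exp (γ * h)) ⟨by linarith, by linarith⟩
    have : η / 2 * (q * Real.exp (γ * h)) ≤
        q * Real.exp (γ * h) + (g u - g (u + q * Real.exp (γ * h))) :=
      le_of_mul_le_mul_left (by linarith) hr
    linarith
end
end

section
/- Assume (H) with L_g = g'(0) and g strictly increasing. Let φ be a wavefront with speed c, and let q* > 0, q_* ∈ (0,κ), δ* ∈ (0,δ₀), γ* > 0 be such that the inequalities (gg1) and (gg) hold. Fix γ ∈ [0, γ*) and λ > 0 satisfying −γ + cλ − λ² + 1 − g'(0)e^{γh}e^{−λch} ≥ 0, and let b > 0 satisfy φ(b − ch) = κ − δ*/2. Let w be a classical solution of (E1) with a bounded initial datum w₀ on Π₀. Then: (i) if w₀(s,z) ≤ φ(z) + q η_λ(z−b) on Π₀ with q ∈ (0, q*], then w(t,z) ≤ φ(z) + q e^{−γt} η_λ(z−b) for all t ≥ −h, z ∈ ℝ; (ii) if φ(z) − q η_λ(z−b) ≤ w₀(s,z) on Π₀ with q ∈ (0, q_*], then φ(z) − q e^{−γt} η_λ(z−b) ≤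 w(t,z) for all t ≥ −h, z ∈ ℝ; (iii) both implications hold for arbitrary q > 0 if η_λ(z−b) is replaced throughout by e^{λz}. -/
open Set Filter

noncomputable section

/-- Inequality (gg1). -/
def GG1 (g : ℝ → ℝ) (kap h dstar qlow gstar : ℝ) : Prop :=
  ∀ u ∈ Set.Icc (kap - dstar) kap, ∀ q ∈ Set.Icc (0:ℝ) qlow,
    ∀ γ ∈ Set.Icc (0:ℝ) gstar,
      g u - g (u - q * Real.exp (γ * h)) ≤ q * (1 - 2 * γ)

/-- Inequality (gg). -/
def GG2 (g : ℝ → ℝ) (kap h dstar qstar gstar : ℝ) : Prop :=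
  ∀ u ∈ Set.Icc (kap - dstar) kap, ∀ q ∈ Set.Icc (0:ℝ) qstar,
    ∀ γ ∈ Set.Icc (0:ℝ) gstar,
      -(q * (1 - 2 * γ)) ≤ g u - g (u + q * Real.exp (γ * h))

/-! ### Calculus facts on the line -/

lemma IsLocalMin.second_deriv_nonneg {f f' : ℝ → ℝ} {f'' x : ℝ}
    (hf : ∀ y, HasDerivAt f (f' y) y) (hf' : HasDerivAt f' f'' x) (hmin : IsLocalMin f x) :
    f' x = 0 ∧ 0 ≤ f'' := by
  have h0 : f' x = 0 := hmin.hasDerivAt_eq_zero (hf x)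
  refine ⟨h0, ?_⟩
  by_contra! hneg
  have hd : deriv f = f' := funext fun y => (hf y).deriv
  have hmax : IsLocalMax f x := by
    apply isLocalMax_of_deriv_deriv_neg
    · rw [hd, hf'.deriv]
      exact hneg
    · rw [hd, h0]
    · exact (hf x).continuousAt
  have hconst : f =ᶠ[nhds x] fun _ => f x := by
    filter_upwards [hmin, hmax] with y h1 h2 using le_antisymm h2 h1
  have h1 : f' =ᶠ[nhds x] fun _ => 0 := by
    have := hconst.deriv
    rw [hd] at this
    simpa using this
  have h2 : deriv f' x = 0 := by
    rw [h1.deriv_eq]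
    simp
  rw [hf'.deriv] at h2
  linarith

lemma HasDerivAt.nonpos_of_le_left {f : ℝ → ℝ} {f' a t : ℝ} (hf : HasDerivAt f f' t) (hat : a < t)
    (hmin : ∀ τ ∈ Icc a t, f t ≤ f τ) : f' ≤ 0 := by
  have hloc : IsLocalMinOn f (Icc a t) t :=
    IsMinOn.localize fun τ hτ => hmin τ hτ
  have hy : a - t ∈ posTangentConeAt (Icc a t) t := by
    apply sub_mem_posTangentConeAt_of_segment_subset
    rw [segment_symm, segment_eq_Icc hat.le]
  have h := hloc.hasFDerivWithinAt_nonneg hf.hasDerivWithinAt.hasFDerivWithinAt hy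
  simp at h
  nlinarith

lemma monotoneOn_of_hasDerivAt_nonneg {f f' : ℝ → ℝ} {s : Set ℝ} (hs : Convex ℝ s)
    (hf : ∀ x, HasDerivAt f (f' x) x) (h : ∀ x ∈ s, 0 ≤ f' x) : MonotoneOn f s := by
  apply monotoneOn_of_deriv_nonneg hs
    (fun x _ => (hf x).continuousAt.continuousWithinAt)
    (fun x _ => (hf x).differentiableAt.differentiableWithinAt)
  intro x hx
  rw [(hf x).deriv]
  exact h x (interior_subset hx)

lemma hasDerivAt_of_limit {ι : Type*} {l : Filter ι} [l.NeBot] {f f' : ι → ℝ → ℝ} {F : ℝ → ℝ}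
    {F' x C : ℝ} (hb : ∀ᶠ n in l, ∀ y, |y - x| ≤ 1 →
      |f n y - f n x - f' n x * (y - x)| ≤ C * (y - x) ^ 2)
    (hF : ∀ y, Tendsto (fun n => f n y) l (nhds (F y)))
    (hF' : Tendsto (fun n => f' n x) l (nhds F')) : HasDerivAt F F' x := by
  have key : ∀ y, |y - x| ≤ 1 → |F y - F x - F' * (y - x)| ≤ C * (y - x) ^ 2 := by
    intro y hy
    refine le_of_tendsto (((hF y).sub (hF x)).sub (hF'.mul_const (y - x))).abs ?_
    filter_upwards [hb] with n hn using hn y hy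
  rw [hasDerivAt_iff_isLittleO]
  have hO : (fun y => F y - F x - (y - x) • F') =O[nhds x] fun y => (y - x) ^ 2 := by
    apply Asymptotics.IsBigO.of_bound C
    filter_upwards [Metric.closedBall_mem_nhds x one_pos] with y hy
    have := key y (by simpa [Real.dist_eq] using hy)
    simp only [Real.norm_eq_abs, smul_eq_mul, abs_pow, sq_abs]
    rw [mul_comm (y - x)]
    exact this
  refine hO.trans_isLittleO ?_
  have h1 : (fun y : ℝ => y - x) =o[nhds x] fun _ => (1 : ℝ) := by
    rw [Asymptotics.isLittleO_one_iff]
    have : Continuous fun y : ℝ => y - x := by fun_prop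
    simpa using this.tendsto x
  have h2 := h1.mul_isBigO (Asymptotics.isBigO_refl (fun y : ℝ => y - x) (nhds x))
  simpa [sq] using h2

/-! ### A minimum principle on a closed subset of the line -/

lemma parabolic_minimum_principle {E Et Ez Ezz : ℝ → ℝ → ℝ} {S : Set ℝ} {c T₀ T₁ M : ℝ}
    (hS : IsClosed S)
    (hcont : ContinuousOn (fun p : ℝ × ℝ => E p.1 p.2) (Icc T₀ T₁ ×ˢ S))
    (hEt : ∀ t ∈ Ioc T₀ T₁, ∀ z, HasDerivAt (fun τ => E τ z) (Et t z) t)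
    (hEz : ∀ t ∈ Ioc T₀ T₁, ∀ z, HasDerivAt (E t) (Ez t z) z)
    (hEzz : ∀ t ∈ Ioc T₀ T₁, ∀ z, HasDerivAt (Ez t) (Ezz t z) z)
    (hbdd : ∀ t ∈ Icc T₀ T₁, ∀ z ∈ S, -M ≤ E t z)
    (hinit : ∀ z ∈ S, 0 ≤ E T₀ z)
    (hbdry : ∀ t ∈ Ioc T₀ T₁, ∀ z ∈ S, z ∉ interior S → 0 ≤ E t z)
    (hineq : ∀ t ∈ Ioc T₀ T₁, ∀ z ∈ interior S, 0 ≤ Et t z - Ezz t z + c * Ez t z + E t z) :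
    ∀ t ∈ Icc T₀ T₁, ∀ z ∈ S, 0 ≤ E t z := by
  intro t₁ ht₁ z₁ hz₁
  by_contra! hneg
  set K : ℝ := 3 + c ^ 2 with hK
  have hKpos : 0 < K := by positivity
  have hP : 0 < z₁ ^ 2 + K := by positivity
  obtain ⟨ε, hε, hε1⟩ : ∃ ε > 0, E t₁ z₁ + ε * (z₁ ^ 2 + K) < 0 := by
    refine ⟨-E t₁ z₁ / (2 * (z₁ ^ 2 + K)), div_pos (by linarith) (by positivity), ?_⟩
    have : -E t₁ z₁ / (2 * (z₁ ^ 2 + K)) * (z₁ ^ 2 + K) = -E t₁ z₁ / 2 := by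
      field_simp
    linarith
  set F : ℝ × ℝ → ℝ := fun p => E p.1 p.2 + ε * (p.2 ^ 2 + K) with hF
  obtain ⟨R, hR0, hR⟩ : ∃ R : ℝ, 0 ≤ R ∧ M ≤ ε * R ^ 2 := by
    refine ⟨√(|M| / ε), Real.sqrt_nonneg _, ?_⟩
    rw [Real.sq_sqrt (by positivity)]
    field_simp
    exact le_abs_self M
  have hfar : ∀ t ∈ Icc T₀ T₁, ∀ z ∈ S, z ∉ Icc (-R) R → 0 < F (t, z) := by
    intro t ht z hz hzR
    have h1 := hbdd t ht z hz
    have h2 : R ^ 2 ≤ z ^ 2 := by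
      rw [sq_le_sq, abs_of_nonneg hR0]
      by_contra! h
      exact hzR (abs_le.mp h.le)
    have h3 : ε * R ^ 2 ≤ ε * z ^ 2 := by gcongr
    have h4 : 0 < ε * K := by positivity
    simp only [hF]
    linarith
  have hcomp : IsCompact (Icc T₀ T₁ ×ˢ (S ∩ Icc (-R) R)) :=
    isCompact_Icc.prod (isCompact_Icc.inter_left hS)
  have hz₁R : z₁ ∈ Icc (-R) R := by
    by_contra h
    have h5 := hfar t₁ ht₁ z₁ hz₁ h
    simp only [hF] at h5
    linarith
  obtain ⟨⟨t₀, z₀⟩, ⟨ht₀, hz₀, -⟩, hmin⟩ := hcomp.exists_isMinOn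
    (f := F) ⟨(t₁, z₁), ht₁, hz₁, hz₁R⟩ (by
      refine ContinuousOn.add (hcont.mono ?_) (by fun_prop)
      exact prod_mono le_rfl inter_subset_left)
  simp only at ht₀ hz₀
  have hF0 : F (t₀, z₀) < 0 := lt_of_le_of_lt (b := F (t₁, z₁)) (hmin ⟨ht₁, hz₁, hz₁R⟩) hε1
  have hminS : ∀ t ∈ Icc T₀ T₁, ∀ z ∈ S, F (t₀, z₀) ≤ F (t, z) := by
    intro t ht z hz
    by_cases h : z ∈ Icc (-R) R
    · exact hmin ⟨ht, hz, h⟩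
    · exact hF0.le.trans (hfar t ht z hz h).le
  have hpen : ∀ z : ℝ, 0 < ε * (z ^ 2 + K) := fun z => by positivity
  have hE0 : E t₀ z₀ < 0 := by
    have := hpen z₀
    simp only [hF] at hF0
    linarith
  have htlt : T₀ < t₀ := by
    rcases ht₀.1.eq_or_lt with h | h
    · exact absurd (hinit z₀ hz₀) (by rw [h]; exact not_le.mpr hE0)
    · exact h
  have ht₀' : t₀ ∈ Ioc T₀ T₁ := ⟨htlt, ht₀.2⟩
  have hzint : z₀ ∈ interior S := by
    by_contra h
    exact absurd (hbdry t₀ ht₀' z₀ hz₀ h) (not_le.mpr hE0)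
  have hEt0 : Et t₀ z₀ ≤ 0 := by
    refine (hEt t₀ ht₀' z₀).nonpos_of_le_left htlt fun τ hτ => ?_
    have := hminS τ ⟨hτ.1, hτ.2.trans ht₀.2⟩ z₀ hz₀
    simp only [hF] at this
    linarith
  have hlocmin : IsLocalMin (fun z => F (t₀, z)) z₀ := by
    filter_upwards [mem_interior_iff_mem_nhds.mp hzint] with z hz using hminS t₀ ht₀ z hz
  have hd1 : ∀ z, HasDerivAt (fun z => F (t₀, z)) (Ez t₀ z + ε * (2 * z)) z := by
    intro z
    refine (hEz t₀ ht₀' z).add (HasDerivAt.const_mul ε ?_)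
    simpa using (hasDerivAt_pow 2 z).add_const K
  have hd2 : HasDerivAt (fun z => Ez t₀ z + ε * (2 * z)) (Ezz t₀ z₀ + ε * 2) z₀ := by
    refine (hEzz t₀ ht₀' z₀).add (HasDerivAt.const_mul ε ?_)
    simpa using (hasDerivAt_id z₀).const_mul 2
  obtain ⟨h1, h2⟩ := hlocmin.second_deriv_nonneg hd1 hd2
  have h3 := hineq t₀ ht₀' z₀ hzint
  have h4 : Ez t₀ z₀ = -(ε * (2 * z₀)) := by linarith
  rw [h4] at h3
  simp only [hF] at hF0
  have h5 : 0 < ε * ((z₀ + c) ^ 2 + 1) := by positivity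
  nlinarith

lemma delayed_minimum_principle {E Et Ez Ezz : ℝ → ℝ → ℝ} {S : Set ℝ} {c h : ℝ} (hh : 0 < h)
    (hS : IsClosed S)
    (hcont : ContinuousOn (fun p : ℝ × ℝ => E p.1 p.2) {p : ℝ × ℝ | -h ≤ p.1})
    (hEt : ∀ t, 0 < t → ∀ z, HasDerivAt (fun τ => E τ z) (Et t z) t)
    (hEz : ∀ t, 0 < t → ∀ z, HasDerivAt (E t) (Ez t z) z)
    (hEzz : ∀ t, 0 < t → ∀ z, HasDerivAt (Ez t) (Ezz t z) z)
    (hbdd : ∀ T, ∃ M, ∀ t ∈ Icc (-h) T, ∀ z ∈ S, -M ≤ E t z)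
    (hinit : ∀ t ∈ Icc (-h) 0, ∀ z ∈ S, 0 ≤ E t z)
    (hbdry : ∀ t, 0 < t → ∀ z ∈ S, z ∉ interior S → 0 ≤ E t z)
    (hineq : ∀ t, 0 < t → (∀ y ∈ S, 0 ≤ E (t - h) y) → ∀ z ∈ interior S,
      0 ≤ Et t z - Ezz t z + c * Ez t z + E t z) :
    ∀ t ≥ -h, ∀ z ∈ S, 0 ≤ E t z := by
  have step : ∀ n : ℕ, ∀ t ∈ Icc (-h) (n * h), ∀ z ∈ S, 0 ≤ E t z := by
    intro n
    induction n with
    | zero => simpa using hinit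
    | succ n ih =>
      have hn : 0 ≤ (n : ℝ) * h := by positivity
      intro t ht z hz
      rcases le_total t (n * h) with hle | hle
      · exact ih t ⟨ht.1, hle⟩ z hz
      obtain ⟨M, hM⟩ := hbdd ((n + 1 : ℕ) * h)
      push_cast at hM ht
      refine parabolic_minimum_principle (E := E) (Et := Et) (Ez := Ez) (Ezz := Ezz) (c := c)
        (T₀ := n * h) (T₁ := (n + 1) * h) (M := M) hS
        (hcont.mono ?_) (fun t ht => hEt t (hn.trans_lt ht.1))
        (fun t ht => hEz t (hn.trans_lt ht.1))
        (fun t ht => hEzz t (hn.trans_lt ht.1)) (fun t ht => hM t ⟨?_, ht.2⟩)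
        (ih _ ⟨by linarith, le_rfl⟩) (fun t ht => hbdry t (hn.trans_lt ht.1))
        (fun t ht => hineq t (hn.trans_lt ht.1) (ih _ ⟨?_, ?_⟩)) t ⟨hle, ht.2⟩ z hz
      · rintro ⟨s, y⟩ ⟨hs, -⟩
        have := hs.1
        change -h ≤ s
        linarith
      · linarith [ht.1]
      · linarith [ht.1]
      · linarith [ht.2]
  intro t ht z hz
  obtain ⟨n, hn⟩ := exists_nat_ge (t / h)
  exact step n t ⟨ht, (div_le_iff₀ hh).mp hn⟩ z hz

/-! ### Comparison of a solution with a perturbed wavefront -/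

lemma wavefront_barrier {g : ℝ → ℝ} {h c kap : ℝ} {φ : ℝ → ℝ} {w : ℝ → ℝ → ℝ} {S : Set ℝ}
    {σ q γ μ : ℝ} (hh : 0 < h) (hφ : IsWavefront g h c kap φ) (hw : SolvesE1 g h c w)
    (hS : IsClosed S) (hq : 0 ≤ q)
    (hinit : ∀ t ∈ Icc (-h) 0, ∀ z ∈ S,
      0 ≤ σ * (φ z - w t z) + q * Real.exp (-(γ * t)) * Real.exp (μ * z))
    (hbdry : ∀ t, 0 < t → ∀ z ∈ S, z ∉ interior S →
      0 ≤ σ * (φ z - w t z) + q * Real.exp (-(γ * t)) * Real.exp (μ * z))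
    (hdelay : ∀ t, 0 < t →
      (∀ y ∈ S, 0 ≤ σ * (φ y - w (t - h) y) +
        q * Real.exp (-(γ * (t - h))) * Real.exp (μ * y)) →
      ∀ z ∈ interior S, 0 ≤ σ * (g (φ (z - c * h)) - g (w (t - h) (z - c * h))) +
        q * Real.exp (-(γ * t)) * Real.exp (μ * z) * (-γ - μ ^ 2 + c * μ + 1)) :
    ∀ t ≥ -h, ∀ z ∈ S,
      0 ≤ σ * (φ z - w t z) + q * Real.exp (-(γ * t)) * Real.exp (μ * z) := by
  obtain ⟨hpos, ⟨B, hB⟩, hC2, hφeq, -, -⟩ := hφ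
  obtain ⟨hwc, hwb, hwd, -, -, -⟩ := hw
  have hφ1 : ∀ z, HasDerivAt φ (deriv φ z) z := fun z =>
    (hC2.differentiable (by norm_num) z).hasDerivAt
  have hφ2 : ∀ z, HasDerivAt (deriv φ) (deriv (deriv φ) z) z := fun z =>
    ((hC2.differentiable_deriv_two) z).hasDerivAt
  have hexpz : ∀ z, HasDerivAt (fun z => Real.exp (μ * z)) (Real.exp (μ * z) * μ) z := fun z => by
    simpa using ((hasDerivAt_id z).const_mul μ).exp
  have hexpt : ∀ t, HasDerivAt (fun t => Real.exp (-(γ * t))) (Real.exp (-(γ * t)) * (-γ)) t :=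
    fun t => by simpa using ((hasDerivAt_id t).const_mul γ).neg.exp
  refine delayed_minimum_principle (c := c)
    (Et := fun t z => σ * (-deriv (fun τ => w τ z) t) +
      q * (Real.exp (-(γ * t)) * (-γ)) * Real.exp (μ * z))
    (Ez := fun t z => σ * (deriv φ z - deriv (fun y => w t y) z) +
      q * Real.exp (-(γ * t)) * (Real.exp (μ * z) * μ))
    (Ezz := fun t z => σ * (deriv (deriv φ) z - deriv (deriv (fun y => w t y)) z) +
      q * Real.exp (-(γ * t)) * (Real.exp (μ * z) * μ * μ)) hh hS ?_ ?_ ?_ ?_ ?_ hinit hbdry ?_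
  · refine ContinuousOn.add (continuousOn_const.mul (ContinuousOn.sub ?_ hwc)) (by fun_prop)
    exact (hC2.continuous.comp continuous_snd).continuousOn
  · intro t ht z
    exact (((hwd t ht z).1.hasDerivAt.const_sub (φ z)).const_mul σ).add
      (((hexpt t).const_mul q).mul_const _)
  · intro t ht z
    exact (((hφ1 z).sub (hwd t ht z).2.1.hasDerivAt).const_mul σ).add
      ((hexpz z).const_mul _)
  · intro t ht z
    exact (((hφ2 z).sub (hwd t ht z).2.2.1.hasDerivAt).const_mul σ).add
      (((hexpz z).mul_const μ).const_mul _)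
  · intro T
    obtain ⟨M, hM⟩ := hwb T
    refine ⟨|σ| * (B + M), fun t ht z _ => ?_⟩
    have h1 : |φ z - w t z| ≤ B + M := by
      refine (abs_sub _ _).trans (add_le_add ?_ (hM t ht z))
      rw [abs_of_pos (hpos z)]
      exact hB z
    have h2 : |σ * (φ z - w t z)| ≤ |σ| * (B + M) := by
      rw [abs_mul]
      gcongr
    have h3 : 0 ≤ q * Real.exp (-(γ * t)) * Real.exp (μ * z) := by positivity
    linarith [neg_abs_le (σ * (φ z - w t z))]
  · intro t ht hprev z hz
    have h1 := hdelay t ht hprev z hz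
    have h2 := (hwd t ht z).2.2.2
    have h3 := hφeq z
    rw [h2]
    have h4 : g (φ (z - c * h)) = -deriv (deriv φ) z + c * deriv φ z + φ z := by linarith
    rw [h4] at h1
    linarith

lemma HypH.sub_le {g : ℝ → ℝ} {kap del0 : ℝ} (hH : HypH g kap del0 (deriv g 0))
    {u v : ℝ} (huv : u ≤ v) : g v - g u ≤ deriv g 0 * (v - u) := by
  have hpos : ∀ x y : ℝ, 0 ≤ x → x ≤ y → g y - g x ≤ deriv g 0 * (y - x) := by
    intro x y hx hxy
    have h1 := hH.lipschitz y x (hx.trans hxy) hx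
    rw [abs_of_nonneg (sub_nonneg.mpr hxy)] at h1
    exact (le_abs_self _).trans h1
  have h0 : g 0 = 0 := by simpa using hH.ext_linear 0 le_rfl
  rcases le_total 0 u with hu | hu
  · exact hpos u v hu huv
  rcases le_total v 0 with hv | hv
  · rw [hH.ext_linear u hu, hH.ext_linear v hv]
    linarith
  · have h1 := hpos 0 v le_rfl hv
    rw [hH.ext_linear u hu]
    linarith

section Squeezing

variable {g : ℝ → ℝ} {kap del0 h c γ lam q : ℝ} {φ : ℝ → ℝ} {w : ℝ → ℝ → ℝ}

lemma exp_barrier_delay (hH : HypH g kap del0 (deriv g 0)) (hmono : StrictMono g)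
    (hkey : 0 ≤ -γ + c * lam - lam ^ 2 + 1
      - deriv g 0 * Real.exp (γ * h) * Real.exp (-(lam * c * h))) (hq : 0 ≤ q) {t z u v : ℝ}
    (huv : u ≤ v + q * Real.exp (-(γ * (t - h))) * Real.exp (lam * (z - c * h))) :
    g u - g v ≤ q * Real.exp (-(γ * t)) * Real.exp (lam * z) *
      (-γ - lam ^ 2 + c * lam + 1) := by
  have hE : Real.exp (-(γ * (t - h))) * Real.exp (lam * (z - c * h)) =
      Real.exp (-(γ * t)) * Real.exp (lam * z) *
        (Real.exp (γ * h) * Real.exp (-(lam * c * h))) := by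
    simp only [← Real.exp_add]
    congr 1
    ring
  rw [mul_assoc, hE] at huv
  have hQ : 0 ≤ q * (Real.exp (-(γ * t)) * Real.exp (lam * z)) := by positivity
  have h1 := hH.sub_le (u := v) (v := v + q * (Real.exp (-(γ * t)) * Real.exp (lam * z) *
        (Real.exp (γ * h) * Real.exp (-(lam * c * h))))) (by
          have : 0 ≤ q * (Real.exp (-(γ * t)) * Real.exp (lam * z) *
            (Real.exp (γ * h) * Real.exp (-(lam * c * h)))) := by positivity
          linarith)
  have h2 := hmono.monotone huv
  have h3 := mul_nonneg hQ hkey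
  nlinarith

lemma exp_upper_barrier (hH : HypH g kap del0 (deriv g 0)) (hmono : StrictMono g) (hh : 0 < h)
    (hφ : IsWavefront g h c kap φ) (hw : SolvesE1 g h c w)
    (hkey : 0 ≤ -γ + c * lam - lam ^ 2 + 1
      - deriv g 0 * Real.exp (γ * h) * Real.exp (-(lam * c * h))) (hγ : 0 ≤ γ) (hq : 0 ≤ q)
    (hinit : ∀ s ∈ Icc (-h) 0, ∀ z, w s z ≤ φ z + q * Real.exp (lam * z)) :
    ∀ t ≥ -h, ∀ z, w t z ≤ φ z + q * Real.exp (-(γ * t)) * Real.exp (lam * z) := by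
  intro t ht z
  have := wavefront_barrier (σ := 1) (q := q) (γ := γ) (μ := lam) hh hφ hw isClosed_univ hq
    (fun s hs y _ => ?_) (fun s _ y _ hy => absurd (by simp) hy) (fun s hs hprev y _ => ?_)
    t ht z (mem_univ z)
  · linarith
  · have h1 := hinit s hs y
    have h2 : 1 ≤ Real.exp (-(γ * s)) := by
      rw [Real.one_le_exp_iff]
      nlinarith [hs.2]
    have h3 : q * Real.exp (lam * y) * 1 ≤ q * Real.exp (lam * y) * Real.exp (-(γ * s)) := by
      gcongr
    linarith
  · have h1 := hprev (y - c * h) (mem_univ _)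
    have := exp_barrier_delay hH hmono hkey hq (t := s) (z := y) (u := w (s - h) (y - c * h))
      (v := φ (y - c * h)) (by linarith)
    linarith

lemma exp_lower_barrier (hH : HypH g kap del0 (deriv g 0)) (hmono : StrictMono g) (hh : 0 < h)
    (hφ : IsWavefront g h c kap φ) (hw : SolvesE1 g h c w)
    (hkey : 0 ≤ -γ + c * lam - lam ^ 2 + 1
      - deriv g 0 * Real.exp (γ * h) * Real.exp (-(lam * c * h))) (hγ : 0 ≤ γ) (hq : 0 ≤ q)
    (hinit : ∀ s ∈ Icc (-h) 0, ∀ z, φ z - q * Real.exp (lam * z) ≤ w s z) :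
    ∀ t ≥ -h, ∀ z, φ z - q * Real.exp (-(γ * t)) * Real.exp (lam * z) ≤ w t z := by
  intro t ht z
  have := wavefront_barrier (σ := -1) (q := q) (γ := γ) (μ := lam) hh hφ hw isClosed_univ hq
    (fun s hs y _ => ?_) (fun s _ y _ hy => absurd (by simp) hy) (fun s hs hprev y _ => ?_)
    t ht z (mem_univ z)
  · linarith
  · have h1 := hinit s hs y
    have h2 : 1 ≤ Real.exp (-(γ * s)) := by
      rw [Real.one_le_exp_iff]
      nlinarith [hs.2]
    have h3 : q * Real.exp (lam * y) * 1 ≤ q * Real.exp (lam * y) * Real.exp (-(γ * s)) := by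
      gcongr
    linarith
  · have h1 := hprev (y - c * h) (mem_univ _)
    have := exp_barrier_delay hH hmono hkey hq (t := s) (z := y) (v := w (s - h) (y - c * h))
      (u := φ (y - c * h)) (by linarith)
    linarith

lemma mul_eta_sub (b : ℝ) (z : ℝ) (hq : 0 ≤ q) :
    q * eta lam (z - b) = min (q * Real.exp (-(lam * b)) * Real.exp (lam * z)) q := by
  rw [eta, mul_min_of_nonneg _ _ hq, mul_one, mul_assoc, ← Real.exp_add]
  congr 3
  ring

lemma const_barrier_delay {t z b σ : ℝ}
    (hprev : ∀ y ∈ Ici b, 0 ≤ σ * (φ y - w (t - h) y) +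
      q * Real.exp (-(γ * (t - h))) * Real.exp (0 * y))
    (hleft : ∀ y, 0 ≤ σ * (φ y - w (t - h) y) +
      q * Real.exp (-(lam * b)) * Real.exp (-(γ * (t - h))) * Real.exp (lam * y))
    (hlam : 0 < lam) (hq : 0 ≤ q) :
    0 ≤ σ * (φ z - w (t - h) z) + q * Real.exp (-(γ * t)) * Real.exp (γ * h) := by
  have hE : Real.exp (-(γ * (t - h))) = Real.exp (-(γ * t)) * Real.exp (γ * h) := by
    rw [← Real.exp_add]
    congr 1
    ring
  rw [mul_assoc, ← hE]
  rcases le_total b z with hz | hz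
  · simpa using hprev z hz
  · have h1 := hleft z
    have h2 : Real.exp (-(lam * b)) * Real.exp (lam * z) ≤ 1 := by
      rw [← Real.exp_add, Real.exp_le_one_iff]
      nlinarith
    have h3 : 0 ≤ q * Real.exp (-(γ * (t - h))) := by positivity
    nlinarith [mul_le_mul_of_nonneg_left h2 h3]

lemma eta_barrier (hh : 0 < h) (hφ : IsWavefront g h c kap φ) (hw : SolvesE1 g h c w)
    {b σ : ℝ} (hγ : 0 ≤ γ) (hlam : 0 < lam) (hq : 0 ≤ q)
    (hinit : ∀ s ∈ Icc (-h) 0, ∀ z, 0 ≤ σ * (φ z - w s z) + q * eta lam (z - b))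
    (hexp : ∀ t ≥ -h, ∀ z, 0 ≤ σ * (φ z - w t z) +
      q * Real.exp (-(lam * b)) * Real.exp (-(γ * t)) * Real.exp (lam * z))
    (hdelay : ∀ t > 0, ∀ z ≥ b, 0 ≤ σ * (φ (z - c * h) - w (t - h) (z - c * h)) +
        q * Real.exp (-(γ * t)) * Real.exp (γ * h) →
      0 ≤ σ * (g (φ (z - c * h)) - g (w (t - h) (z - c * h))) +
        q * Real.exp (-(γ * t)) * (1 - γ)) :
    ∀ t ≥ -h, ∀ z, 0 ≤ σ * (φ z - w t z) + q * Real.exp (-(γ * t)) * eta lam (z - b) := by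
  simp only [mul_eta_sub _ _ hq] at hinit
  have hright := wavefront_barrier (σ := σ) (q := q) (γ := γ) (μ := 0) hh hφ hw
    (isClosed_Ici (a := b)) hq
    (fun s hs y _ => ?_) (fun s hs y hy hy' => ?_) (fun s hs hprev y hy => ?_)
  · intro t ht z
    have h0 : 0 ≤ q * Real.exp (-(γ * t)) := by positivity
    rw [mul_eta_sub _ _ h0]
    rcases le_total b z with hz | hz
    · rw [min_eq_right]
      · simpa using hright t ht z hz
      · rw [mul_assoc, ← Real.exp_add]
        apply le_mul_of_one_le_right h0
        rw [Real.one_le_exp_iff]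
        nlinarith
    · rw [min_eq_left]
      · linarith [hexp t ht z]
      · rw [mul_assoc, ← Real.exp_add]
        apply mul_le_of_le_one_right h0
        rw [Real.exp_le_one_iff]
        nlinarith
  · have h1 := (hinit s hs y).trans (add_le_add_right (min_le_right _ _) _)
    have h2 : 1 ≤ Real.exp (-(γ * s)) := by
      rw [Real.one_le_exp_iff]
      nlinarith [hs.2]
    have h3 : q * 1 ≤ q * Real.exp (-(γ * s)) := by gcongr
    simp only [zero_mul, Real.exp_zero, mul_one]
    linarith
  · rw [interior_Ici, mem_Ioi, not_lt] at hy'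
    have h1 := hexp s (by linarith) y
    rw [le_antisymm hy' hy] at h1 ⊢
    have h2 : Real.exp (-(lam * b)) * Real.exp (lam * b) = 1 := by
      rw [← Real.exp_add]
      simp
    have h3 : q * Real.exp (-(lam * b)) * Real.exp (-(γ * s)) * Real.exp (lam * b) =
        q * Real.exp (-(γ * s)) := by
      linear_combination q * Real.exp (-(γ * s)) * h2
    simp only [zero_mul, Real.exp_zero, mul_one]
    linarith
  · rw [interior_Ici] at hy
    have h1 := hdelay s hs y (le_of_lt hy) (const_barrier_delay (lam := lam) hprev
      (hexp (s - h) (by linarith)) hlam hq)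
    simp only [zero_mul, Real.exp_zero, mul_one]
    linarith

lemma eta_upper_barrier (hH : HypH g kap del0 (deriv g 0)) (hmono : StrictMono g) (hh : 0 < h)
    (hφ : IsWavefront g h c kap φ) (hw : SolvesE1 g h c w)
    (hkey : 0 ≤ -γ + c * lam - lam ^ 2 + 1
      - deriv g 0 * Real.exp (γ * h) * Real.exp (-(lam * c * h)))
    {b qstar dstar gstar : ℝ} (hγ : γ ∈ Ico 0 gstar) (hlam : 0 < lam)
    (hGG2 : GG2 g kap h dstar qstar gstar)
    (hφb : ∀ z ≥ b, φ (z - c * h) ∈ Icc (kap - dstar) kap)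
    (hq : 0 ≤ q) (hqstar : q ≤ qstar)
    (hinit : ∀ s ∈ Icc (-h) 0, ∀ z, w s z ≤ φ z + q * eta lam (z - b)) :
    ∀ t ≥ -h, ∀ z, w t z ≤ φ z + q * Real.exp (-(γ * t)) * eta lam (z - b) := by
  have hexp := exp_upper_barrier hH hmono hh hφ hw hkey hγ.1
    (q := q * Real.exp (-(lam * b))) (by positivity) (fun s hs z => (hinit s hs z).trans (by
      rw [mul_eta_sub _ _ hq]
      gcongr
      exact min_le_left _ _))
  intro t ht z
  have := eta_barrier (σ := 1) hh hφ hw hγ.1 hlam hq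
    (fun s hs y => by linarith [hinit s hs y]) (fun s hs y => by linarith [hexp s hs y])
    (fun s hs y hy h1 => ?_) t ht z
  · linarith
  · have h2 : Real.exp (-(γ * s)) ≤ 1 := by
      rw [Real.exp_le_one_iff]
      nlinarith [hγ.1]
    have h3 := hGG2 (φ (y - c * h)) (hφb y hy) (q * Real.exp (-(γ * s)))
      ⟨by positivity, (mul_le_of_le_one_right hq h2).trans hqstar⟩ γ ⟨hγ.1, hγ.2.le⟩
    have h4 : w (s - h) (y - c * h) ≤
        φ (y - c * h) + q * Real.exp (-(γ * s)) * Real.exp (γ * h) := by linarith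
    have h5 := hmono.monotone h4
    have h6 : 0 ≤ q * Real.exp (-(γ * s)) * γ := mul_nonneg (by positivity) hγ.1
    linarith

lemma eta_lower_barrier (hH : HypH g kap del0 (deriv g 0)) (hmono : StrictMono g) (hh : 0 < h)
    (hφ : IsWavefront g h c kap φ) (hw : SolvesE1 g h c w)
    (hkey : 0 ≤ -γ + c * lam - lam ^ 2 + 1
      - deriv g 0 * Real.exp (γ * h) * Real.exp (-(lam * c * h)))
    {b qlow dstar gstar : ℝ} (hγ : γ ∈ Ico 0 gstar) (hlam : 0 < lam)
    (hGG1 : GG1 g kap h dstar qlow gstar)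
    (hφb : ∀ z ≥ b, φ (z - c * h) ∈ Icc (kap - dstar) kap)
    (hq : 0 ≤ q) (hqlow : q ≤ qlow)
    (hinit : ∀ s ∈ Icc (-h) 0, ∀ z, φ z - q * eta lam (z - b) ≤ w s z) :
    ∀ t ≥ -h, ∀ z, φ z - q * Real.exp (-(γ * t)) * eta lam (z - b) ≤ w t z := by
  have hexp := exp_lower_barrier hH hmono hh hφ hw hkey hγ.1
    (q := q * Real.exp (-(lam * b))) (by positivity) (fun s hs z => le_trans (by
      rw [mul_eta_sub _ _ hq]
      gcongr
      exact min_le_left _ _) (hinit s hs z))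
  intro t ht z
  have := eta_barrier (σ := -1) hh hφ hw hγ.1 hlam hq
    (fun s hs y => by linarith [hinit s hs y]) (fun s hs y => by linarith [hexp s hs y])
    (fun s hs y hy h1 => ?_) t ht z
  · linarith
  · have h2 : Real.exp (-(γ * s)) ≤ 1 := by
      rw [Real.exp_le_one_iff]
      nlinarith [hγ.1]
    have h3 := hGG1 (φ (y - c * h)) (hφb y hy) (q * Real.exp (-(γ * s)))
      ⟨by positivity, (mul_le_of_le_one_right hq h2).trans hqlow⟩ γ ⟨hγ.1, hγ.2.le⟩
    have h4 : φ (y - c * h) - q * Real.exp (-(γ * s)) * Real.exp (γ * h) ≤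
        w (s - h) (y - c * h) := by linarith
    have h5 := hmono.monotone h4
    have h6 : 0 ≤ q * Real.exp (-(γ * s)) * γ := mul_nonneg (by positivity) hγ.1
    linarith

end Squeezing

/-! ### Growth estimates for positive solutions of a linear second order equation -/

lemma deriv_le_mul_of_pos {φ φ₁ G : ℝ → ℝ} {c ρ : ℝ} (hpos : ∀ z, 0 < φ z)
    (h1 : ∀ z, HasDerivAt φ (φ₁ z) z)
    (h2 : ∀ z, HasDerivAt φ₁ (c * φ₁ z + φ z - G z) z)
    (hG : ∀ z, 0 ≤ G z) (hρ : 0 < ρ) (hroot : ρ ^ 2 = c * ρ + 1) (x : ℝ) :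
    φ₁ x ≤ ρ * φ x := by
  by_contra! hneg
  set k := φ₁ x - ρ * φ x with hk
  have hk0 : 0 < k := by linarith
  have hs : c - ρ ≤ 0 := by
    by_contra! h
    nlinarith
  have hexp : ∀ z, HasDerivAt (fun z => Real.exp (-((c - ρ) * z)))
      (Real.exp (-((c - ρ) * z)) * (-(c - ρ))) z := fun z => by
    simpa using ((hasDerivAt_id z).const_mul (c - ρ)).neg.exp
  have hp : ∀ z, HasDerivAt (fun z => -(Real.exp (-((c - ρ) * z)) * (φ₁ z - ρ * φ z)))
      (Real.exp (-((c - ρ) * z)) * G z) z := fun z => by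
    refine ((hexp z).mul ((h2 z).sub ((h1 z).const_mul ρ))).neg.congr_deriv ?_
    simp only [Pi.sub_apply]
    linear_combination (Real.exp (-((c - ρ) * z)) * φ z) * hroot
  have hmono := monotoneOn_of_hasDerivAt_nonneg convex_univ hp fun z _ =>
    mul_nonneg (Real.exp_pos _).le (hG z)
  have hlow : ∀ z ≤ x, k ≤ φ₁ z := by
    intro z hz
    have h3 := hmono (mem_univ z) (mem_univ x) hz
    simp only [neg_le_neg_iff] at h3
    have h4 : Real.exp (-((c - ρ) * z)) ≤ Real.exp (-((c - ρ) * x)) := by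
      apply Real.exp_le_exp.mpr
      nlinarith
    have h5 : k * Real.exp (-((c - ρ) * z)) ≤
        (φ₁ z - ρ * φ z) * Real.exp (-((c - ρ) * z)) := by
      calc k * Real.exp (-((c - ρ) * z)) ≤ k * Real.exp (-((c - ρ) * x)) := by gcongr
        _ ≤ _ := by linarith
    have h6 := le_of_mul_le_mul_right h5 (Real.exp_pos _)
    have := mul_pos hρ (hpos z)
    linarith
  have hd : ∀ z, HasDerivAt (fun z => φ z - k * z) (φ₁ z - k) z := fun z =>
    ((h1 z).sub ((hasDerivAt_id z).const_mul k)).congr_deriv (by ring)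
  have hle : x - φ x / k ≤ x := sub_le_self _ (div_nonneg (hpos x).le hk0.le)
  have h7 := monotoneOn_of_hasDerivAt_nonneg (convex_Iic x) hd
    (fun z hz => sub_nonneg.mpr (hlow z hz)) (mem_Iic.mpr hle) (mem_Iic.mpr le_rfl) hle
  simp only at h7
  have h8 : k * (x - φ x / k) = k * x - φ x := by field_simp
  have := hpos (x - φ x / k)
  linarith

lemma exists_pos_root (c : ℝ) : ∃ ρ > 0, ρ ^ 2 = c * ρ + 1 := by
  have h := Real.sq_sqrt (show 0 ≤ c ^ 2 + 4 by positivity)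
  have h0 := Real.sqrt_nonneg (c ^ 2 + 4)
  refine ⟨(c + √(c ^ 2 + 4)) / 2, ?_, by nlinarith⟩
  by_contra! hle
  nlinarith

lemma exists_abs_deriv_le_mul {φ φ₁ G : ℝ → ℝ} {c : ℝ} (hpos : ∀ z, 0 < φ z)
    (h1 : ∀ z, HasDerivAt φ (φ₁ z) z)
    (h2 : ∀ z, HasDerivAt φ₁ (c * φ₁ z + φ z - G z) z) (hG : ∀ z, 0 ≤ G z) :
    ∃ C > 0, ∀ z, |φ₁ z| ≤ C * φ z := by
  obtain ⟨ρ, hρ, hroot⟩ := exists_pos_root c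
  obtain ⟨σ, hσ, hroot'⟩ := exists_pos_root (-c)
  refine ⟨max ρ σ, lt_max_of_lt_left hρ, fun z => abs_le'.mpr ⟨?_, ?_⟩⟩
  · exact (deriv_le_mul_of_pos hpos h1 h2 hG hρ hroot z).trans
      (mul_le_mul_of_nonneg_right (le_max_left _ _) (hpos z).le)
  · have h3 := deriv_le_mul_of_pos (φ := fun z => φ (-z)) (φ₁ := fun z => -φ₁ (-z))
      (G := fun z => G (-z)) (c := -c) (fun z => hpos _)
      (fun z => ((h1 (-z)).comp z (hasDerivAt_neg z)).congr_deriv (by ring))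
      (fun z => ((h2 (-z)).comp z (hasDerivAt_neg z)).neg.congr_deriv (by ring))
      (fun z => hG _) hσ hroot' (-z)
    simp only [neg_neg] at h3
    exact h3.trans (mul_le_mul_of_nonneg_right (le_max_right _ _) (hpos z).le)

lemma le_exp_mul_of_abs_deriv_le {φ φ₁ : ℝ → ℝ} {C : ℝ}
    (h1 : ∀ z, HasDerivAt φ (φ₁ z) z) (hC : ∀ z, |φ₁ z| ≤ C * φ z) (x y : ℝ) :
    φ y ≤ Real.exp (C * |y - x|) * φ x := by
  have hexp : ∀ D z : ℝ, HasDerivAt (fun z => Real.exp (D * z)) (Real.exp (D * z) * D) z :=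
    fun D z => by simpa using ((hasDerivAt_id z).const_mul D).exp
  rcases le_total x y with hxy | hxy
  · have h3 := monotoneOn_of_hasDerivAt_nonneg convex_univ
      (fun z => ((hexp (-C) z).mul (h1 z)).neg) (fun z _ => by
        have := mul_nonneg (Real.exp_pos (-C * z)).le
          (sub_nonneg.mpr ((le_abs_self _).trans (hC z)))
        linarith) (mem_univ x) (mem_univ y) hxy
    simp only [Pi.neg_apply, Pi.mul_apply, neg_le_neg_iff] at h3
    have h4 : φ y = Real.exp (C * y) * (Real.exp (-C * y) * φ y) := by
      rw [← mul_assoc, ← Real.exp_add]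
      simp
    rw [abs_of_nonneg (sub_nonneg.mpr hxy), h4]
    calc _ ≤ Real.exp (C * y) * (Real.exp (-C * x) * φ x) := by gcongr
      _ = _ := by
        rw [← mul_assoc, ← Real.exp_add]
        ring_nf
  · have h3 := monotoneOn_of_hasDerivAt_nonneg convex_univ
      (fun z => (hexp C z).mul (h1 z)) (fun z _ => by
        have := mul_nonneg (Real.exp_pos (C * z)).le
          (neg_le_iff_add_nonneg.mp (neg_le_of_neg_le ((neg_le_abs _).trans (hC z))))
        linarith) (mem_univ y) (mem_univ x) hxy
    simp only [Pi.mul_apply] at h3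
    have h4 : φ y = Real.exp (-C * y) * (Real.exp (C * y) * φ y) := by
      rw [← mul_assoc, ← Real.exp_add]
      simp
    rw [abs_of_nonpos (sub_nonpos.mpr hxy), h4]
    calc _ ≤ Real.exp (-C * y) * (Real.exp (C * x) * φ x) := by gcongr
      _ = _ := by
        rw [← mul_assoc, ← Real.exp_add]
        ring_nf

lemma abs_sub_le_of_abs_deriv_le {f f' : ℝ → ℝ} {x L : ℝ} (hf : ∀ z, HasDerivAt f (f' z) z)
    {d : ℝ} (hb : ∀ z, |z - x| ≤ d → |f' z| ≤ L) {y : ℝ} (hy : |y - x| ≤ d) :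
    |f y - f x| ≤ L * |y - x| := by
  have hmem : ∀ z, z ∈ Metric.closedBall x d ↔ |z - x| ≤ d := fun z => by
    rw [Metric.mem_closedBall, Real.dist_eq]
  have hd : 0 ≤ d := (abs_nonneg _).trans hy
  exact (convex_closedBall x d).norm_image_sub_le_of_norm_hasDerivWithin_le
    (fun z _ => (hf z).hasDerivWithinAt) (fun z hz => hb z ((hmem z).mp hz))
    (Metric.mem_closedBall_self hd) ((hmem y).mpr hy)

lemma abs_taylor_le {f f' : ℝ → ℝ} {x L : ℝ} (hf : ∀ z, HasDerivAt f (f' z) z) (hL0 : 0 ≤ L)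
    (hL : ∀ z, |z - x| ≤ 1 → |f' z - f' x| ≤ L * |z - x|) {y : ℝ} (hy : |y - x| ≤ 1) :
    |f y - f x - f' x * (y - x)| ≤ L * (y - x) ^ 2 := by
  have h := abs_sub_le_of_abs_deriv_le (f := fun z => f z - f' x * z) (f' := fun z => f' z - f' x)
    (x := x) (y := y) (d := |y - x|) (L := L * |y - x|)
    (fun z => ((hf z).sub ((hasDerivAt_id z).const_mul (f' x))).congr_deriv (by ring))
    (fun z hz => (hL z (hz.trans hy)).trans (by gcongr)) le_rfl
  rw [mul_assoc, abs_mul_abs_self, ← sq] at h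
  convert h using 2
  ring

/-! ### Asymptotics of the profile at `-∞` -/

lemma linear_delay_no_decay {u u₁ : ℝ → ℝ} {a c d m : ℝ} (ha : 1 < a) (hc : 0 < c) (hd : 0 < d)
    (hu : ∀ z, HasDerivAt u (u₁ z) z)
    (hu₁ : ∀ z, HasDerivAt u₁ (c * u₁ z + u z - a * u (z - d)) z)
    (hlow : ∀ z, m * u z ≤ u₁ z) (hu0 : u 0 = 1) (hu10 : u₁ 0 = m) (hm : m ≤ 0)
    (hupos : ∀ z, 0 ≤ u z) : False := by
  obtain ⟨ρ, hρ, hroot⟩ := exists_pos_root c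
  set v : ℝ → ℝ := fun z => u₁ z - m * u z with hv
  set v₁ : ℝ → ℝ := fun z => c * u₁ z + u z - a * u (z - d) - m * u₁ z with hv₁
  have hv_nonneg : ∀ z, 0 ≤ v z := fun z => sub_nonneg.mpr (hlow z)
  have hv0 : v 0 = 0 := by simp [hv, hu0, hu10]
  have hvd : ∀ z, HasDerivAt v (v₁ z) z := fun z => (hu₁ z).sub ((hu z).const_mul m)
  have hshift : ∀ z, HasDerivAt (fun z => u (z - d)) (u₁ (z - d)) z := fun z =>
    (hu (z - d)).comp_sub_const z d
  have hvd₁ : ∀ z, HasDerivAt v₁ (c * v₁ z + v z - a * v (z - d)) z := fun z => by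
    have := (((hu₁ z).const_mul c).add (hu z)).sub ((hshift z).const_mul a) |>.sub
      ((hu₁ z).const_mul m)
    refine this.congr_deriv ?_
    simp only [hv, hv₁]
    ring
  have hv10 : v₁ 0 = 0 := by
    refine IsLocalMin.hasDerivAt_eq_zero (Eventually.of_forall fun z => ?_) (hvd 0)
    rw [hv0]
    exact hv_nonneg z
  have hexp : ∀ D z : ℝ, HasDerivAt (fun z => Real.exp (D * z)) (Real.exp (D * z) * D) z :=
    fun D z => by simpa using ((hasDerivAt_id z).const_mul D).exp
  have hp : ∀ z, HasDerivAt (fun z => -(Real.exp (-(c - ρ) * z) * (v₁ z - ρ * v z)))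
      (Real.exp (-(c - ρ) * z) * (a * v (z - d))) z := fun z => by
    refine ((hexp (-(c - ρ)) z).mul ((hvd₁ z).sub ((hvd z).const_mul ρ))).neg.congr_deriv ?_
    simp only [Pi.sub_apply]
    linear_combination (Real.exp (-(c - ρ) * z) * v z) * hroot
  have hp_nonneg : ∀ z ≤ 0, 0 ≤ v₁ z - ρ * v z := by
    intro z hz
    have h3 := monotoneOn_of_hasDerivAt_nonneg convex_univ hp (fun z _ =>
      mul_nonneg (Real.exp_pos _).le (mul_nonneg (by linarith) (hv_nonneg _)))
      (mem_univ z) (mem_univ 0) hz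
    simp only [hv0, hv10, mul_zero, sub_zero, neg_zero] at h3
    exact nonneg_of_mul_nonneg_right (by linarith) (Real.exp_pos _)
  have hv_zero : ∀ z ≤ 0, v z = 0 := by
    intro z hz
    have h3 := monotoneOn_of_hasDerivAt_nonneg (convex_Iic 0)
      (fun z => (hexp (-ρ) z).mul (hvd z)) (fun z hz => by
        have := mul_nonneg (Real.exp_pos (-ρ * z)).le (hp_nonneg z hz)
        linarith) (mem_Iic.mpr hz) (mem_Iic.mpr le_rfl) hz
    simp only [Pi.mul_apply, hv0, mul_zero] at h3
    exact le_antisymm (nonpos_of_mul_nonpos_right h3 (Real.exp_pos _)) (hv_nonneg z)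
  have hge : 1 ≤ u (-d) := by
    have h3 := monotoneOn_of_hasDerivAt_nonneg (convex_Iic 0) (fun z => (hu z).neg)
      (fun z hz => by
        have h4 := hv_zero z hz
        have := mul_nonneg (neg_nonneg.mpr hm) (hupos z)
        simp only [hv] at h4
        linarith) (mem_Iic.mpr (by linarith : -d ≤ 0)) (mem_Iic.mpr le_rfl) (by linarith)
    simp only [Pi.neg_apply, hu0] at h3
    linarith
  simp only [hv₁, hu0, hu10, zero_sub] at hv10
  nlinarith [mul_nonneg hc.le (neg_nonneg.mpr hm), sq_nonneg m]

lemma exists_uniform_taylor_bound {φ φ₁ g : ℝ → ℝ} {a c d : ℝ} (ha : 0 < a) (hc : 0 < c)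
    (hd : 0 < d) (hpos : ∀ z, 0 < φ z) (h1 : ∀ z, HasDerivAt φ (φ₁ z) z)
    (h2 : ∀ z, HasDerivAt φ₁ (c * φ₁ z + φ z - g (φ (z - d))) z) (hg0 : g 0 = 0)
    (hglip : ∀ u v, |g v - g u| ≤ a * |v - u|) {C : ℝ} (hC0 : 0 < C)
    (hC : ∀ z, |φ₁ z| ≤ C * φ z) :
    ∃ K ≥ 0, ∀ x y, |y - x| ≤ 1 →
      |φ y - φ x - φ₁ x * (y - x)| ≤ K * φ x * (y - x) ^ 2 ∧
      |φ₁ y - φ₁ x - (c * φ₁ x + φ x - g (φ (x - d))) * (y - x)| ≤ K * φ x * (y - x) ^ 2 := by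
  have hharnack := le_exp_mul_of_abs_deriv_le h1 hC
  have hnear : ∀ x y, |y - x| ≤ 1 → φ y ≤ Real.exp C * φ x := fun x y hxy =>
    (hharnack x y).trans (mul_le_mul_of_nonneg_right
      (Real.exp_le_exp.mpr (mul_le_of_le_one_right hC0.le hxy)) (hpos x).le)
  have hdelay : ∀ x, φ (x - d) ≤ Real.exp (C * d) * φ x := fun x => by
    simpa [abs_of_pos hd] using hharnack x (x - d)
  have hlip : ∀ x y, |y - x| ≤ 1 → |φ y - φ x| ≤ C * Real.exp C * φ x * |y - x| := by
    intro x y hxy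
    refine abs_sub_le_of_abs_deriv_le h1 (d := 1) (fun z hz => (hC z).trans ?_) hxy
    rw [mul_assoc]
    exact mul_le_mul_of_nonneg_left (hnear x z hz) hC0.le
  set C₂ := c * C + 1 + a * Real.exp (C * d) with hC₂
  have hC₂pos : 0 < C₂ := by positivity
  have hφ₂ : ∀ z, |c * φ₁ z + φ z - g (φ (z - d))| ≤ C₂ * φ z := by
    intro z
    have h3 := hglip 0 (φ (z - d))
    rw [hg0, sub_zero, sub_zero, abs_of_pos (hpos _)] at h3
    calc |c * φ₁ z + φ z - g (φ (z - d))|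
        ≤ |c * φ₁ z| + |φ z| + |g (φ (z - d))| :=
          (abs_sub _ _).trans (add_le_add_left (abs_add_le _ _) _)
      _ = c * |φ₁ z| + φ z + |g (φ (z - d))| := by
          rw [abs_mul, abs_of_pos hc, abs_of_pos (hpos z)]
      _ ≤ c * (C * φ z) + φ z + a * (Real.exp (C * d) * φ z) := by
          gcongr
          · exact hC z
          · exact h3.trans (mul_le_mul_of_nonneg_left (hdelay z) ha.le)
      _ = C₂ * φ z := by ring
  have hlip₁ : ∀ x y, |y - x| ≤ 1 → |φ₁ y - φ₁ x| ≤ C₂ * Real.exp C * φ x * |y - x| := by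
    intro x y hxy
    refine abs_sub_le_of_abs_deriv_le h2 (d := 1) (fun z hz => (hφ₂ z).trans ?_) hxy
    rw [mul_assoc]
    exact mul_le_mul_of_nonneg_left (hnear x z hz) hC₂pos.le
  set L := c * (C₂ * Real.exp C) + C * Real.exp C + a * (C * Real.exp C * Real.exp (C * d)) with hL
  have hL0 : 0 ≤ L := by positivity
  have hlip₂ : ∀ x y, |y - x| ≤ 1 →
      |(c * φ₁ y + φ y - g (φ (y - d))) - (c * φ₁ x + φ x - g (φ (x - d)))| ≤
        L * φ x * |y - x| := by
    intro x y hxy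
    have hxy' : y - d - (x - d) = y - x := by ring
    have h4 := hlip (x - d) (y - d) (by rwa [hxy'])
    rw [hxy'] at h4
    have h5 : |g (φ (y - d)) - g (φ (x - d))| ≤
        a * (C * Real.exp C * (Real.exp (C * d) * φ x) * |y - x|) := by
      refine (hglip _ _).trans (mul_le_mul_of_nonneg_left (h4.trans ?_) ha.le)
      gcongr
      exact hdelay x
    calc _ = |c * (φ₁ y - φ₁ x) + (φ y - φ x) - (g (φ (y - d)) - g (φ (x - d)))| := by
          congr 1
          ring
      _ ≤ |c * (φ₁ y - φ₁ x)| + |φ y - φ x| + |g (φ (y - d)) - g (φ (x - d))| :=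
          (abs_sub _ _).trans (add_le_add_left (abs_add_le _ _) _)
      _ ≤ c * (C₂ * Real.exp C * φ x * |y - x|) + C * Real.exp C * φ x * |y - x| +
          a * (C * Real.exp C * (Real.exp (C * d) * φ x) * |y - x|) := by
          rw [abs_mul, abs_of_pos hc]
          gcongr
          · exact hlip₁ x y hxy
          · exact hlip x y hxy
      _ = L * φ x * |y - x| := by ring
  refine ⟨max (C₂ * Real.exp C) L, le_max_of_le_right hL0, fun x y hxy => ⟨?_, ?_⟩⟩
  · refine (abs_taylor_le h1 (mul_nonneg (by positivity) (hpos x).le) (hlip₁ x) hxy).trans ?_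
    have := (hpos x).le
    gcongr
    exact le_max_left _ _
  · refine (abs_taylor_le h2 (mul_nonneg hL0 (hpos x).le) (hlip₂ x) hxy).trans ?_
    have := (hpos x).le
    gcongr
    exact le_max_right _ _

lemma Ultrafilter.exists_tendsto_of_abs_le {ι : Type*} (U : Ultrafilter ι) {f : ι → ℝ} {B : ℝ}
    (hf : ∀ i, |f i| ≤ B) : ∃ L, Tendsto f U (nhds L) := by
  obtain ⟨L, -, hL⟩ := (isCompact_Icc (a := -B) (b := B)).ultrafilter_le_nhds (U.map f)
    (by
      rw [Ultrafilter.coe_map, le_principal_iff]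
      exact mem_map.mpr (univ_mem' fun i => abs_le.mp (hf i)))
  exact ⟨L, hL⟩

lemma eventually_deriv_nonneg_atBot {φ φ₁ g : ℝ → ℝ} {a c d : ℝ} (ha : 1 < a) (hc : 0 < c)
    (hd : 0 < d) (hpos : ∀ z, 0 < φ z) (h1 : ∀ z, HasDerivAt φ (φ₁ z) z)
    (h2 : ∀ z, HasDerivAt φ₁ (c * φ₁ z + φ z - g (φ (z - d))) z) (hg0 : g 0 = 0)
    (hgnonneg : ∀ x, 0 ≤ x → 0 ≤ g x)
    (hglip : ∀ u v, |g v - g u| ≤ a * |v - u|) (hgd : HasDerivAt g a 0)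
    (hbot : Tendsto φ atBot (nhds 0)) : ∀ᶠ z in atBot, 0 ≤ φ₁ z := by
  obtain ⟨C, hC0, hC⟩ := exists_abs_deriv_le_mul hpos h1 h2 fun z => hgnonneg _ (hpos _).le
  obtain ⟨K, hK0, hK⟩ := exists_uniform_taylor_bound (by linarith) hc hd hpos h1 h2 hg0 hglip hC0 hC
  have hharnack := le_exp_mul_of_abs_deriv_le h1 hC
  by_contra hcon
  set r : ℝ → ℝ := fun z => φ₁ z / φ z with hr
  have hrC : ∀ z, |r z| ≤ C := fun z => by
    rw [hr, abs_div, abs_of_pos (hpos z), div_le_iff₀ (hpos z)]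
    exact hC z
  have hfreq : ∃ᶠ z in atBot, r z < 0 := fun hev => hcon <| by
    filter_upwards [hev] with z hz
    by_contra! hneg
    exact hz (div_neg_of_neg_of_pos hneg (hpos z))
  have hbdd : IsBoundedUnder (· ≥ ·) atBot r :=
    isBoundedUnder_of ⟨-C, fun z => (abs_le.mp (hrC z)).1⟩
  have hcobdd : IsCoboundedUnder (· ≥ ·) atBot r :=
    IsBoundedUnder.isCoboundedUnder_ge (isBoundedUnder_of ⟨C, fun z => (abs_le.mp (hrC z)).2⟩)
  set m := liminf r atBot with hm
  have hm0 : m ≤ 0 := liminf_le_of_frequently_le (hfreq.mono fun z hz => hz.le) hbdd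
  have hge : ∀ ε > 0, ∀ᶠ z in atBot, m - ε < r z := fun ε hε =>
    eventually_lt_of_lt_liminf (by linarith) hbdd
  have hclu : MapClusterPt m atBot r := by
    rw [mapClusterPt_iff_frequently]
    intro s hs
    obtain ⟨ε, hε, hball⟩ := Metric.mem_nhds_iff.mp hs
    have hlt : ∃ᶠ z in atBot, r z < m + ε := frequently_lt_of_liminf_lt hcobdd (by linarith)
    refine (hlt.and_eventually (hge ε hε)).mono fun z hz => hball ?_
    rw [Metric.mem_ball, Real.dist_eq, abs_lt]
    constructor <;> linarith [hz.1, hz.2]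
  obtain ⟨U, hU, hUm⟩ := mapClusterPt_iff_ultrafilter.mp hclu
  have hshift : ∀ z, Tendsto (fun ζ => ζ + z) U atBot := fun z => by
    have h3 : Tendsto (fun ζ : ℝ => ζ + z) atBot atBot :=
      tendsto_atBot_add_const_right atBot z tendsto_id
    refine Tendsto.mono_left h3 ?_
    exact hU
  have hratio : ∀ z ζ, φ (ζ + z) / φ ζ ≤ Real.exp (C * |z|) := fun z ζ => by
    rw [div_le_iff₀ (hpos ζ)]
    simpa using hharnack ζ (ζ + z)
  have hratio_pos : ∀ z ζ, 0 < φ (ζ + z) / φ ζ := fun z ζ => div_pos (hpos _) (hpos _)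
  have hr_mul : ∀ z ζ, φ₁ (ζ + z) / φ ζ = r (ζ + z) * (φ (ζ + z) / φ ζ) := fun z ζ => by
    have h3 := (hpos (ζ + z)).ne'
    have h4 := (hpos ζ).ne'
    simp only [hr]
    field_simp
  have hex : ∀ z, ∃ L, Tendsto (fun ζ => φ (ζ + z) / φ ζ) U (nhds L) := fun z =>
    U.exists_tendsto_of_abs_le fun ζ => by
      rw [abs_of_pos (hratio_pos z ζ)]
      exact hratio z ζ
  have hex₁ : ∀ z, ∃ L, Tendsto (fun ζ => φ₁ (ζ + z) / φ ζ) U (nhds L) := fun z =>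
    U.exists_tendsto_of_abs_le (B := C * Real.exp (C * |z|)) fun ζ => by
      rw [hr_mul, abs_mul, abs_of_pos (hratio_pos z ζ)]
      exact mul_le_mul (hrC _) (hratio z ζ) (hratio_pos z ζ).le hC0.le
  choose u hu using hex
  choose u₁ hu₁ using hex₁
  have hquot : ∀ z, Tendsto (fun ζ => g (φ (ζ + z)) / φ ζ) U (nhds (a * u z)) := by
    intro z
    have h3 : Tendsto (fun y => y⁻¹ * g y) (nhdsWithin 0 {0}ᶜ) (nhds a) := by
      have := hgd.tendsto_slope_zero
      simpa [hg0] using this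
    have h4 : Tendsto (fun ζ => φ (ζ + z)) U (nhdsWithin 0 {0}ᶜ) :=
      tendsto_nhdsWithin_iff.mpr ⟨hbot.comp (hshift z), Eventually.of_forall fun ζ => (hpos _).ne'⟩
    refine ((h3.comp h4).mul (hu z)).congr fun ζ => ?_
    have h5 := (hpos (ζ + z)).ne'
    have h6 := (hpos ζ).ne'
    simp only [Function.comp_apply]
    field_simp
  have hcoef : ∀ x y ζ : ℝ, K * φ (ζ + x) * (y - x) ^ 2 / φ ζ ≤
      K * Real.exp (C * |x|) * (y - x) ^ 2 := fun x y ζ => by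
    have := mul_le_mul_of_nonneg_left (hratio x ζ) (mul_nonneg hK0 (sq_nonneg (y - x)))
    calc _ = K * (y - x) ^ 2 * (φ (ζ + x) / φ ζ) := by ring
      _ ≤ _ := by linarith
  have hud : ∀ z, HasDerivAt u (u₁ z) z := by
    intro x
    refine hasDerivAt_of_limit (l := (U : Filter ℝ)) (f := fun ζ z => φ (ζ + z) / φ ζ)
      (f' := fun ζ z => φ₁ (ζ + z) / φ ζ) (C := K * Real.exp (C * |x|))
      (Eventually.of_forall fun ζ y hy => ?_) hu (hu₁ x)
    have h3 := (hK (ζ + x) (ζ + y) (by simpa using hy)).1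
    rw [add_sub_add_left_eq_sub] at h3
    refine le_trans ?_ (hcoef x y ζ)
    rw [le_div_iff₀ (hpos ζ), ← abs_of_pos (hpos ζ), ← abs_mul, abs_of_pos (hpos ζ)]
    have h6 := (hpos ζ).ne'
    refine le_trans (le_of_eq (congrArg abs ?_)) h3
    field_simp
  have hu₁d : ∀ z, HasDerivAt u₁ (c * u₁ z + u z - a * u (z - d)) z := by
    intro x
    refine hasDerivAt_of_limit (l := (U : Filter ℝ)) (f := fun ζ z => φ₁ (ζ + z) / φ ζ)
      (f' := fun ζ z => c * (φ₁ (ζ + z) / φ ζ) + φ (ζ + z) / φ ζ - g (φ (ζ + (z - d))) / φ ζ)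
      (C := K * Real.exp (C * |x|)) (Eventually.of_forall fun ζ y hy => ?_) hu₁
      ((((hu₁ x).const_mul c).add (hu x)).sub (hquot (x - d)))
    have h3 := (hK (ζ + x) (ζ + y) (by simpa using hy)).2
    rw [add_sub_add_left_eq_sub, add_sub_assoc] at h3
    refine le_trans ?_ (hcoef x y ζ)
    rw [le_div_iff₀ (hpos ζ), ← abs_of_pos (hpos ζ), ← abs_mul, abs_of_pos (hpos ζ)]
    have h6 := (hpos ζ).ne'
    refine le_trans (le_of_eq (congrArg abs ?_)) h3
    rw [← add_sub_assoc]
    field_simp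
    ring
  have hu_nonneg : ∀ z, 0 ≤ u z := fun z =>
    ge_of_tendsto' (hu z) fun ζ => (hratio_pos z ζ).le
  refine linear_delay_no_decay ha hc hd hud hu₁d (fun z => ?_) ?_ ?_ hm0 hu_nonneg
  · have h3 : ∀ ε > 0, (m - ε) * u z ≤ u₁ z := fun ε hε => by
      refine le_of_tendsto_of_tendsto ((hu z).const_mul (m - ε)) (hu₁ z) ?_
      filter_upwards [(hshift z).eventually (hge ε hε)] with ζ hζ
      rw [hr_mul]
      exact mul_le_mul_of_nonneg_right hζ.le (hratio_pos z ζ).le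
    refine le_of_forall_pos_le_add fun δ hδ => ?_
    have h4 := hu_nonneg z
    have h5 := h3 (δ / (u z + 1)) (by positivity)
    have h6 : δ / (u z + 1) * u z ≤ δ := by
      rw [div_mul_eq_mul_div, div_le_iff₀ (by positivity)]
      nlinarith
    linarith
  · refine tendsto_nhds_unique (hu 0) (tendsto_const_nhds.congr fun ζ => ?_)
    simp [(hpos ζ).ne']
  · refine tendsto_nhds_unique (hu₁ 0) (hUm.congr fun ζ => ?_)
    simp [hr]

/-! ### Monotonicity of the profile -/

lemma HypH.lt_self {g : ℝ → ℝ} {kap del0 Lg : ℝ} (hH : HypH g kap del0 Lg) {x : ℝ}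
    (hx : kap < x) : g x < x := by
  have hgk : g kap = kap := (hH.fixed_points kap hH.kap_pos.le).mpr (Or.inr rfl)
  have hne : ∀ y, kap < y → g y ≠ y := fun y hy h => by
    rcases (hH.fixed_points y (hH.kap_pos.trans hy).le).mp h with h0 | h0 <;>
      linarith [hH.kap_pos]
  have hdiff : DifferentiableAt ℝ g kap :=
    (hH.smooth_kap.differentiableOn one_ne_zero).differentiableAt
      (Ioo_mem_nhds (by linarith [hH.del0_pos]) (by linarith [hH.del0_pos]))
  have hd : HasDerivAt (fun y => g y - y) (deriv g kap - 1) kap :=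
    hdiff.hasDerivAt.sub (hasDerivAt_id kap)
  by_contra! hle
  have hlt : x < g x := lt_of_le_of_ne hle (hne x hx).symm
  have hpos : ∀ y ∈ Ioc kap x, 0 ≤ g y - y := by
    intro y hy
    by_contra! hneg
    obtain ⟨z, hz, hz0⟩ := intermediate_value_Icc hy.2
      (f := fun y => g y - y) (hH.cont.sub continuous_id).continuousOn
      (show (0 : ℝ) ∈ Icc _ _ from ⟨hneg.le, by linarith⟩)
    exact hne z (hy.1.trans_le hz.1) (by linarith)
  have hslope := (hasDerivAt_iff_tendsto_slope.mp hd).mono_left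
    (nhdsWithin_mono kap (t := {kap}ᶜ) (s := Ioi kap) fun y (hy : kap < y) => hy.ne')
  have : 0 ≤ deriv g kap - 1 := by
    refine ge_of_tendsto hslope ?_
    filter_upwards [Ioc_mem_nhdsGT hx] with y hy
    rw [slope_def_field, hgk, sub_self, sub_zero]
    exact div_nonneg (hpos y hy) (by linarith [hy.1])
  linarith [hH.deriv_kap_lt]

section Profile

variable {g : ℝ → ℝ} {kap del0 h c : ℝ} {φ : ℝ → ℝ}

lemma IsWavefront.hasDerivAt (hφ : IsWavefront g h c kap φ) (z : ℝ) :
    HasDerivAt φ (deriv φ z) z :=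
  (hφ.2.2.1.differentiable (by norm_num) z).hasDerivAt

lemma IsWavefront.hasDerivAt_deriv (hφ : IsWavefront g h c kap φ) (z : ℝ) :
    HasDerivAt (deriv φ) (c * deriv φ z + φ z - g (φ (z - c * h))) z := by
  have h1 := ((hφ.2.2.1.differentiable_deriv_two) z).hasDerivAt
  have h2 := hφ.2.2.2.1 z
  exact h1.congr_deriv (by linarith)

lemma IsWavefront.le_kap {Lg : ℝ} (hH : HypH g kap del0 Lg) (hmono : StrictMono g)
    (hφ : IsWavefront g h c kap φ) (z : ℝ) : φ z ≤ kap := by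
  by_contra! hz
  have hev : ∀ᶠ x in cocompact ℝ, φ x ≤ φ z := by
    rw [cocompact_eq_atBot_atTop, eventually_sup]
    exact ⟨(hφ.2.2.2.2.1.eventually_lt_const (hφ.1 z)).mono fun x hx => hx.le,
      (hφ.2.2.2.2.2.eventually_lt_const hz).mono fun x hx => hx.le⟩
  obtain ⟨z₀, hz₀⟩ := hφ.2.2.1.continuous.exists_forall_ge' z hev
  obtain ⟨h1, h2⟩ := IsLocalMin.second_deriv_nonneg (f := fun z => -φ z)
    (fun y => (hφ.hasDerivAt y).neg) (hφ.hasDerivAt_deriv z₀).neg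
    (Eventually.of_forall fun y => neg_le_neg (hz₀ y))
  have h3 := hmono.monotone (hz₀ (z₀ - c * h))
  have h4 := hH.lt_self (hz.trans_le (hz₀ z))
  rw [neg_eq_zero.mp h1] at h2
  linarith

lemma IsWavefront.eventually_deriv_nonneg (hH : HypH g kap del0 (deriv g 0)) (hmono : StrictMono g)
    (hh : 0 < h) (hc : 0 < c) (hφ : IsWavefront g h c kap φ) :
    ∀ᶠ z in atBot, 0 ≤ deriv φ z := by
  have hg0 : g 0 = 0 := by simpa using hH.ext_linear 0 le_rfl
  refine eventually_deriv_nonneg_atBot hH.deriv0_gt hc (mul_pos hc hh) hφ.1 hφ.hasDerivAt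
    hφ.hasDerivAt_deriv hg0 hH.nonneg (fun u v => ?_)
    (differentiableAt_of_deriv_ne_zero (by linarith [hH.deriv0_gt])).hasDerivAt hφ.2.2.2.2.1
  rcases le_total u v with huv | huv
  · rw [abs_of_nonneg (sub_nonneg.mpr huv), abs_of_nonneg (sub_nonneg.mpr (hmono.monotone huv))]
    exact hH.sub_le huv
  · rw [abs_of_nonpos (sub_nonpos.mpr huv), abs_of_nonpos (sub_nonpos.mpr (hmono.monotone huv)),
      neg_sub, neg_sub]
    exact hH.sub_le huv

lemma IsWavefront.monotone (hH : HypH g kap del0 (deriv g 0)) (hmono : StrictMono g)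
    (hh : 0 < h) (hc : 0 < c) (hφ : IsWavefront g h c kap φ) {lam : ℝ} (hlam : 0 < lam)
    (hkey : 0 ≤ c * lam - lam ^ 2 + 1 - deriv g 0 * Real.exp (-(lam * c * h))) :
    Monotone φ := by
  obtain ⟨Z, hZ⟩ := eventually_atBot.mp (hφ.eventually_deriv_nonneg hH hmono hh hc)
  have hmonoZ : MonotoneOn φ (Iic Z) :=
    monotoneOn_of_hasDerivAt_nonneg (convex_Iic Z) hφ.hasDerivAt fun x hx => hZ x hx
  suffices key : ∀ τ > 0, ∀ z, 0 ≤ φ (z + τ) - φ z by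
    intro x y hxy
    rcases hxy.eq_or_lt with rfl | hlt
    · exact le_rfl
    · simpa using key (y - x) (sub_pos.mpr hlt) x
  intro τ hτ z₁
  by_contra! hneg
  have hφc := hφ.2.2.1.continuous
  set D : ℝ → ℝ := fun z => φ (z + τ) - φ z with hD
  set p : ℝ → ℝ := fun z => D z * Real.exp (-(lam * z)) with hp
  have hpc : Continuous p := by fun_prop
  have hD_eq : ∀ z, D z = p z * Real.exp (lam * z) := fun z => by
    rw [hp]
    simp only [mul_assoc, ← Real.exp_add]
    simp
  have hp1 : p z₁ < 0 := mul_neg_of_neg_of_pos hneg (Real.exp_pos _)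
  have hp_left : ∀ z ≤ Z - τ, 0 ≤ p z := fun z hz =>
    mul_nonneg (sub_nonneg.mpr (hmonoZ (mem_Iic.mpr (by linarith)) (mem_Iic.mpr (by linarith))
      (by linarith))) (Real.exp_pos _).le
  have hp_top : Tendsto p atTop (nhds 0) := by
    have h1 : Tendsto D atTop (nhds (kap - kap)) :=
      (hφ.2.2.2.2.2.comp (tendsto_atTop_add_const_right atTop τ tendsto_id)).sub hφ.2.2.2.2.2
    have h2 : Tendsto (fun z => Real.exp (-(lam * z))) atTop (nhds 0) :=
      Real.tendsto_exp_neg_atTop_nhds_zero.comp (tendsto_id.const_mul_atTop hlam)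
    simpa using h1.mul h2
  have hev : ∀ᶠ x in cocompact ℝ, p z₁ ≤ p x := by
    rw [cocompact_eq_atBot_atTop, eventually_sup]
    constructor
    · filter_upwards [eventually_le_atBot (Z - τ)] with z hz using hp1.le.trans (hp_left z hz)
    · exact (hp_top.eventually_const_lt hp1).mono fun x hx => hx.le
  obtain ⟨zm, hzm⟩ := hpc.exists_forall_le' z₁ hev
  set A : Set ℝ := {z | p z = p zm} with hA
  have hAclosed : IsClosed A := isClosed_eq hpc continuous_const
  have hAbdd : BddBelow A := ⟨Z - τ, fun z (hz : p z = p zm) => by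
    by_contra! hlt
    have := hp_left z hlt.le
    linarith [hzm z₁]⟩
  set z₀ := sInf A with hz₀
  have hz₀A : p z₀ = p zm := hAclosed.csInf_mem ⟨zm, rfl⟩ hAbdd
  set ε := -p zm with hε
  have hε0 : 0 < ε := by linarith [hzm z₁]
  have hstrict : ∀ z < z₀, -ε < p z := fun z hz => by
    rw [hε, neg_neg]
    exact lt_of_le_of_ne (hzm z) fun he => notMem_of_lt_csInf hz hAbdd he.symm
  have hexp : ∀ z, HasDerivAt (fun z => Real.exp (lam * z)) (Real.exp (lam * z) * lam) z :=
    fun z => by simpa using ((hasDerivAt_id z).const_mul lam).exp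
  have hD1 : ∀ z, HasDerivAt (fun z => D z + ε * Real.exp (lam * z))
      (deriv φ (z + τ) - deriv φ z + ε * (Real.exp (lam * z) * lam)) z := fun z =>
    (((hφ.hasDerivAt (z + τ)).comp_add_const z τ).sub (hφ.hasDerivAt z)).add
      ((hexp z).const_mul ε)
  have hD2 := (((hφ.hasDerivAt_deriv (z₀ + τ)).comp_add_const z₀ τ).sub
    (hφ.hasDerivAt_deriv z₀)).add (((hexp z₀).mul_const lam).const_mul ε)
  have hmin : IsLocalMin (fun z => D z + ε * Real.exp (lam * z)) z₀ := by
    refine Eventually.of_forall fun z => ?_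
    simp only [hD_eq, ← add_mul]
    rw [hz₀A, hε, add_neg_cancel, zero_mul]
    exact mul_nonneg (by linarith [hzm z]) (Real.exp_pos _).le
  obtain ⟨h1, h2⟩ := hmin.second_deriv_nonneg hD1 hD2
  have hDz₀ : φ (z₀ + τ) - φ z₀ = -ε * Real.exp (lam * z₀) := by
    have := hD_eq z₀
    rw [hz₀A] at this
    simpa [hε] using this
  have hdelay : φ (z₀ - c * h) - φ (z₀ + τ - c * h) <
      ε * (Real.exp (lam * z₀) * Real.exp (-(lam * c * h))) := by
    have h3 := mul_lt_mul_of_pos_right (hstrict (z₀ - c * h) (by linarith [mul_pos hc hh]))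
      (Real.exp_pos (lam * (z₀ - c * h)))
    rw [← hD_eq] at h3
    have h4 : Real.exp (lam * z₀) * Real.exp (-(lam * c * h)) = Real.exp (lam * (z₀ - c * h)) := by
      rw [← Real.exp_add]
      ring_nf
    have h5 : z₀ - c * h + τ = z₀ + τ - c * h := by ring
    simp only [hD, h5] at h3
    rw [h4]
    linarith
  set P := Real.exp (lam * z₀) with hP
  have hP0 : 0 < P := Real.exp_pos _
  set Q := Real.exp (-(lam * c * h)) with hQ
  have hQ0 : 0 < Q := Real.exp_pos _
  have hg : g (φ (z₀ - c * h)) - g (φ (z₀ + τ - c * h)) < deriv g 0 * (ε * (P * Q)) := by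
    have ha := hH.deriv0_gt
    rcases le_total (φ (z₀ + τ - c * h)) (φ (z₀ - c * h)) with hle | hle
    · refine (hH.sub_le hle).trans_lt ?_
      gcongr
    · have h6 := hmono.monotone hle
      have : 0 < deriv g 0 * (ε * (P * Q)) := by positivity
      linarith
  have h7 : 0 < ε * P * (lam ^ 2 - c * lam - 1 + deriv g 0 * Q) := by
    linear_combination h2 + c * h1 + hg + hDz₀
  have h8 := mul_nonneg (mul_pos hε0 hP0).le hkey
  linarith

end Profile

/-- **Lemma (squeezing between shifted fronts; Lemma `Sttg`).**
With `L_g = g'(0)`, a wavefront `φ`, constants realizing (gg1) and (gg), `γ ∈ [0,γ*)`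
and `λ > 0` with `−γ + cλ − λ² + 1 − g'(0)e^{γh}e^{−λch} ≥ 0`, and `b` with
`φ(b−ch) = κ − δ*/2`: an initial sandwich of width `q·η_λ(z−b)` propagates as a
sandwich of width `q·e^{−γt}η_λ(z−b)`; with weight `e^{λz}` no size restriction on
`q` is needed. -/
theorem squeezing_lemma
    (g : ℝ → ℝ) (kap del0 Lg h c : ℝ)
    (hH : HypH g kap del0 Lg) (hmono : StrictMono g) (hLg : Lg = deriv g 0)
    (hh : 0 < h) (hc : 0 < c)
    (φ : ℝ → ℝ) (hφ : IsWavefront g h c kap φ)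
    (qstar qlow dstar gstar : ℝ)
    (hqstar : 0 < qstar) (hqlow : qlow ∈ Set.Ioo 0 kap)
    (hdstar : dstar ∈ Set.Ioo (0:ℝ) del0) (hgstar : 0 < gstar)
    (hGG1 : GG1 g kap h dstar qlow gstar)
    (hGG2 : GG2 g kap h dstar qstar gstar)
    (γ lam : ℝ) (hγ : γ ∈ Set.Ico 0 gstar) (hlam : 0 < lam)
    (hkey : 0 ≤ -γ + c * lam - lam ^ 2 + 1
        - deriv g 0 * Real.exp (γ * h) * Real.exp (-(lam * c * h)))
    (b : ℝ) (hb : 0 < b) (hbφ : φ (b - c * h) = kap - dstar / 2)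
    -- w : a classical solution of (E1) with bounded initial datum w₀
    (w0 : ℝ → ℝ → ℝ) (hbdd : ∃ M : ℝ, ∀ s ∈ Set.Icc (-h) 0, ∀ z : ℝ, |w0 s z| ≤ M)
    (w : ℝ → ℝ → ℝ) (hw : SolvesE1 g h c w)
    (hinit : ∀ s ∈ Set.Icc (-h) 0, ∀ z : ℝ, w s z = w0 s z) :
    -- (i) upper squeezing, for 0 < q ≤ q*
    (∀ q : ℝ, 0 < q → q ≤ qstar →
      (∀ s ∈ Set.Icc (-h) 0, ∀ z : ℝ, w0 s z ≤ φ z + q * eta lam (z - b)) →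
      ∀ t ≥ -h, ∀ z : ℝ, w t z ≤ φ z + q * Real.exp (-(γ * t)) * eta lam (z - b)) ∧
    -- (ii) lower squeezing, for 0 < q ≤ q_*
    (∀ q : ℝ, 0 < q → q ≤ qlow →
      (∀ s ∈ Set.Icc (-h) 0, ∀ z : ℝ, φ z - q * eta lam (z - b) ≤ w0 s z) →
      ∀ t ≥ -h, ∀ z : ℝ, φ z - q * Real.exp (-(γ * t)) * eta lam (z - b) ≤ w t z) ∧
    -- (iii) with the weight ξ(z,λ)=e^{λz}, no upper restriction on q is needed
    (∀ q : ℝ, 0 < q →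
      ((∀ s ∈ Set.Icc (-h) 0, ∀ z : ℝ, w0 s z ≤ φ z + q * Real.exp (lam * z)) →
        ∀ t ≥ -h, ∀ z : ℝ, w t z ≤ φ z + q * Real.exp (-(γ * t)) * Real.exp (lam * z)) ∧
      ((∀ s ∈ Set.Icc (-h) 0, ∀ z : ℝ, φ z - q * Real.exp (lam * z) ≤ w0 s z) →
        ∀ t ≥ -h, ∀ z : ℝ, φ z - q * Real.exp (-(γ * t)) * Real.exp (lam * z) ≤ w t z)) := by
  subst hLg
  have h0 : 0 ≤ c * lam - lam ^ 2 + 1 - deriv g 0 * Real.exp (-(lam * c * h)) := by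
    have h1 : 1 ≤ Real.exp (γ * h) := Real.one_le_exp (mul_nonneg hγ.1 hh.le)
    have h2 : deriv g 0 * Real.exp (-(lam * c * h)) * 1 ≤
        deriv g 0 * Real.exp (-(lam * c * h)) * Real.exp (γ * h) :=
      mul_le_mul_of_nonneg_left h1
        (mul_nonneg (by linarith [hH.deriv0_gt]) (Real.exp_pos _).le)
    linarith [hγ.1]
  have hφmono := hφ.monotone hH hmono hh hc hlam h0
  have hφb : ∀ z ≥ b, φ (z - c * h) ∈ Icc (kap - dstar) kap := fun z hz => by
    refine ⟨?_, hφ.le_kap hH hmono _⟩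
    have := hφmono (sub_le_sub_right hz (c * h))
    linarith [hdstar.1]
  refine ⟨fun q hq hqs hi => ?_, fun q hq hqs hi => ?_, fun q hq => ⟨fun hi => ?_, fun hi => ?_⟩⟩
  · exact eta_upper_barrier hH hmono hh hφ hw hkey hγ hlam hGG2 hφb hq.le hqs
      fun s hs z => (hinit s hs z).trans_le (hi s hs z)
  · exact eta_lower_barrier hH hmono hh hφ hw hkey hγ hlam hGG1 hφb hq.le hqs
      fun s hs z => (hi s hs z).trans_eq (hinit s hs z).symm
  · exact exp_upper_barrier hH hmono hh hφ hw hkey hγ.1 hq.le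
      fun s hs z => (hinit s hs z).trans_le (hi s hs z)
  · exact exp_lower_barrier hH hmono hh hφ hw hkey hγ.1 hq.le
      fun s hs z => (hi s hs z).trans_eq (hinit s hs z).symm
end
end
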